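/- The third homotopy group of the special unitary group SU(8), based at the identity matrix, is infinite cyclic: there is a group isomorphism π₃(SU(8), 1) ≅ ℤ. -/

import Mathlib

open scoped Topology

section PointwiseProduct

open scoped Topology.Homotopy unitInterval

namespace GenLoop

/-- The class of a generalized loop in the homotopy group. -/
def toClass {N X : Type*} [TopologicalSpace X] {x : X} (f : Ω^ N X x) : HomotopyGroup N X x :=
  Quotient.mk _ f

theorem toClass_eq_iff {N X : Type*} [TopologicalSpace X] {x : X} {f g : Ω^ N X x} :
    toClass f = toClass g ↔ Homotopic f g :=
  Quotient.eq

theorem homotopic_of_continuous {N X : Type*} [TopologicalSpace X] {x : X} {f g : Ω^ N X x}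
    (H : I × (I^N) → X) (hH : Continuous H) (h₀ : ∀ y, H (0, y) = f y) (h₁ : ∀ y, H (1, y) = g y)
    (hb : ∀ t, ∀ y ∈ Cube.boundary N, H (t, y) = x) : Homotopic f g :=
  ⟨⟨⟨⟨H, hH⟩, h₀, h₁⟩, fun t y hy => (hb t y hy).trans (f.2 y hy).symm⟩⟩

variable {N G : Type*} [TopologicalSpace G] [Monoid G] [ContinuousMul G]

/-- The pointwise product of two generalized loops based at the identity of a topological monoid. -/
def pmul (f g : Ω^ N G (1 : G)) : Ω^ N G (1 : G) :=
  ⟨f.1 * g.1, fun y hy => by simp [f.2 y hy, g.2 y hy]⟩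

@[simp]
theorem pmul_apply (f g : Ω^ N G (1 : G)) (y : I^N) : pmul f g y = f y * g y := rfl

theorem Homotopic.pmul {f₁ f₂ g₁ g₂ : Ω^ N G (1 : G)} (hf : Homotopic f₁ f₂)
    (hg : Homotopic g₁ g₂) : Homotopic (pmul f₁ g₁) (GenLoop.pmul f₂ g₂) := by
  obtain ⟨F⟩ := hf
  obtain ⟨F'⟩ := hg
  refine homotopic_of_continuous (fun z => F z * F' z) (by fun_prop) (fun y => ?_) (fun y => ?_)
    fun t y hy => ?_
  · rw [F.apply_zero, F'.apply_zero]; rfl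
  · rw [F.apply_one, F'.apply_one]; rfl
  · rw [F.eq_fst t hy, F'.eq_fst t hy, coe_coe, coe_coe, boundary f₁ y hy, boundary g₁ y hy,
      one_mul]

/-- The group law on the homotopy groups of a topological monoid is the pointwise product. -/
theorem toClass_pmul [DecidableEq N] [Nonempty N] (f g : Ω^ N G (1 : G)) :
    toClass (pmul g f) = toClass f * toClass g := by
  let i : N := Classical.arbitrary N
  have key : ∀ p q : Ω^ N G (1 : G), toClass p * toClass q = toClass (transAt i q p) :=
    fun p q => HomotopyGroup.mul_spec
  have one : toClass (const : Ω^ N G (1 : G)) = 1 := rfl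
  have hf : Homotopic f (transAt i const f) := by
    rw [← toClass_eq_iff, ← key, one, mul_one]
  have hg : Homotopic g (transAt i g const) := by
    rw [← toClass_eq_iff, ← key, one, one_mul]
  rw [key, toClass_eq_iff]
  refine (hg.pmul hf).trans ?_
  have : GenLoop.pmul (transAt i g const) (transAt i const f) = transAt i g f := by
    ext y
    simp only [pmul_apply, transAt, coe_copy]
    split_ifs <;> simp
  rw [this]

theorem toClass_symmAt {X : Type*} [TopologicalSpace X] {x : X} [DecidableEq N] [Nonempty N]
    (i : N) (f : Ω^ N X x) : toClass (symmAt i f) = (toClass f)⁻¹ :=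
  HomotopyGroup.inv_spec.symm

end GenLoop

end PointwiseProduct

section Transport

namespace Matrix

open scoped ComplexConjugate

variable {n : Type*} [Fintype n]

/-- The unit vector in the direction of `v`. -/
noncomputable def unitVec (v : n → ℂ) : n → ℂ :=
  (((Real.sqrt (star v ⬝ᵥ v).re)⁻¹ : ℝ) : ℂ) • v

theorem star_dotProduct_self_eq (v : n → ℂ) : star v ⬝ᵥ v = ((star v ⬝ᵥ v).re : ℂ) := by
  have h : conj (star v ⬝ᵥ v) = star v ⬝ᵥ v := by
    simp [dotProduct, mul_comm]
  exact (Complex.conj_eq_iff_re.mp h).symm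

theorem star_dotProduct_self_re_nonneg (v : n → ℂ) : 0 ≤ (star v ⬝ᵥ v).re := by
  simp only [dotProduct, Complex.re_sum, Pi.star_apply, RCLike.star_def]
  refine Finset.sum_nonneg fun i _ => ?_
  simp only [Complex.mul_re, Complex.conj_re, Complex.conj_im]
  nlinarith [sq_nonneg (v i).re, sq_nonneg (v i).im]

theorem star_dotProduct_self_re_pos {v : n → ℂ} (hv : v ≠ 0) : 0 < (star v ⬝ᵥ v).re := by
  refine lt_of_le_of_ne (star_dotProduct_self_re_nonneg v) fun h => hv ?_
  have := star_dotProduct_self_eq v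
  rw [← h, Complex.ofReal_zero] at this
  open scoped ComplexOrder in exact dotProduct_star_self_eq_zero.mp this

theorem star_dotProduct_unitVec {v : n → ℂ} (hv : v ≠ 0) : star (unitVec v) ⬝ᵥ unitVec v = 1 := by
  have h := star_dotProduct_self_re_pos hv
  have hs : Real.sqrt (star v ⬝ᵥ v).re ≠ 0 := (Real.sqrt_pos.mpr h).ne'
  rw [unitVec, star_smul, smul_dotProduct, dotProduct_smul, star_dotProduct_self_eq v]
  simp only [RCLike.star_def, Complex.conj_ofReal, smul_eq_mul]
  norm_cast
  field_simp
  exact (Real.sq_sqrt h.le).symm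

theorem unitVec_of_unit {v : n → ℂ} (hv : star v ⬝ᵥ v = 1) : unitVec v = v := by
  simp [unitVec, hv]

theorem exists_unitVec_eq {v : n → ℂ} (hv : v ≠ 0) : ∃ r : ℝ, 0 < r ∧ unitVec v = (r : ℂ) • v :=
  ⟨_, inv_pos.mpr (Real.sqrt_pos.mpr (star_dotProduct_self_re_pos hv)), rfl⟩

theorem continuousOn_unitVec : ContinuousOn (unitVec : (n → ℂ) → n → ℂ) {v | v ≠ 0} := by
  refine ContinuousOn.smul (Complex.continuous_ofReal.comp_continuousOn ?_) continuousOn_id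
  refine ContinuousOn.inv₀ (Continuous.continuousOn ?_) fun v hv =>
    (Real.sqrt_pos.mpr (star_dotProduct_self_re_pos hv)).ne'
  fun_prop

theorem one_add_star_dotProduct_ne_zero {a b : n → ℂ} (ha : star a ⬝ᵥ a = 1)
    (hb : star b ⬝ᵥ b = 1) (hab : a + b ≠ 0) : 1 + star a ⬝ᵥ b ≠ 0 := by
  intro h
  have h₁ : star a ⬝ᵥ b = -1 := by linear_combination h
  have h₂ : star b ⬝ᵥ a = -1 := by
    rw [← star_star (star b ⬝ᵥ a), ← star_dotProduct_star, star_star, h₁]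
    simp
  refine (star_dotProduct_self_re_pos hab).ne' ?_
  rw [star_add, add_dotProduct, dotProduct_add, dotProduct_add, ha, hb, h₁, h₂]
  simp

variable [DecidableEq n]

/-- A unitary matrix which takes the unit vector `b` to the unit vector `a`, and which depends
continuously on `a` and `b` as long as `a ≠ -b`. -/
noncomputable def transport (a b : n → ℂ) : Matrix n n ℂ :=
  (1 - (1 + star a ⬝ᵥ b)⁻¹ • vecMulVec (a + b) (star (a + b))) *
    (1 - (2 : ℂ) • vecMulVec b (star b))

theorem one_sub_smul_vecMulVec_mul (u : n → ℂ) (x y : ℂ) :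
    (1 - x • vecMulVec u (star u)) * (1 - y • vecMulVec u (star u)) =
      1 - (x + y - x * y * (star u ⬝ᵥ u)) • vecMulVec u (star u) := by
  have h : vecMulVec u (star u) * vecMulVec u (star u) =
      (star u ⬝ᵥ u) • vecMulVec u (star u) := by
    rw [vecMulVec_mul_vecMulVec]
    ext i j
    simp [vecMulVec_apply]; ring
  simp only [sub_mul, mul_sub, one_mul, mul_one, smul_mul_smul_comm, h, smul_smul]
  module

theorem star_one_sub_smul_vecMulVec (u : n → ℂ) (x : ℂ) :
    star (1 - x • vecMulVec u (star u)) = 1 - star x • vecMulVec u (star u) := by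
  rw [star_sub, star_one, star_smul, star_eq_conjTranspose (vecMulVec _ _),
    conjTranspose_vecMulVec, star_star]

theorem one_sub_smul_vecMulVec_mem_unitaryGroup {u : n → ℂ} {x : ℂ}
    (h : x + star x = x * star x * (star u ⬝ᵥ u)) :
    1 - x • vecMulVec u (star u) ∈ unitaryGroup n ℂ := by
  rw [mem_unitaryGroup_iff, star_one_sub_smul_vecMulVec, one_sub_smul_vecMulVec_mul, h]
  simp

theorem transport_mem_unitaryGroup {a b : n → ℂ} (ha : star a ⬝ᵥ a = 1)
    (hb : star b ⬝ᵥ b = 1) (hab : 1 + star a ⬝ᵥ b ≠ 0) : transport a b ∈ unitaryGroup n ℂ := by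
  refine mul_mem (one_sub_smul_vecMulVec_mem_unitaryGroup ?_)
    (one_sub_smul_vecMulVec_mem_unitaryGroup ?_)
  · have h : star b ⬝ᵥ a = star (star a ⬝ᵥ b) := by
      rw [← star_dotProduct_star, star_star, dotProduct_comm]
    have hk : star (1 + star a ⬝ᵥ b) ≠ 0 := star_ne_zero.mpr hab
    rw [star_add a b, add_dotProduct, dotProduct_add, dotProduct_add, ha, hb, h, star_inv₀]
    field_simp
    rw [star_add, star_one]
    ring
  · rw [hb]; simp; norm_num

theorem transport_self {b : n → ℂ} (hb : star b ⬝ᵥ b = 1) : transport b b = 1 := by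
  have h : (1 + star b ⬝ᵥ b)⁻¹ • vecMulVec (b + b) (star (b + b)) =
      (2 : ℂ) • vecMulVec b (star b) := by
    rw [hb]
    ext i j
    simp [vecMulVec_apply]; ring
  rw [transport, h, one_sub_smul_vecMulVec_mul, hb]
  norm_num

theorem one_sub_smul_vecMulVec_mulVec (u v : n → ℂ) (x : ℂ) :
    (1 - x • vecMulVec u (star u)) *ᵥ v = v - (x * (star u ⬝ᵥ v)) • u := by
  rw [sub_mulVec, smul_mulVec, vecMulVec_mulVec, one_mulVec]
  ext i
  simp
  ring

theorem transport_mulVec {a b : n → ℂ} (hb : star b ⬝ᵥ b = 1) (hab : 1 + star a ⬝ᵥ b ≠ 0) :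
    transport a b *ᵥ b = a := by
  rw [transport, ← mulVec_mulVec, one_sub_smul_vecMulVec_mulVec b, hb]
  have : b - ((2 : ℂ) * 1) • b = -b := by module
  rw [this, one_sub_smul_vecMulVec_mulVec, dotProduct_neg, star_add, add_dotProduct, hb,
    add_comm (star a ⬝ᵥ b), mul_neg, inv_mul_cancel₀ hab]
  module

theorem transport_mulVec_single {a b : n → ℂ} {j : n} (ha : a j = 0) (hb : b j = 0) :
    transport a b *ᵥ Pi.single j 1 = Pi.single j 1 := by
  rw [transport, ← mulVec_mulVec, one_sub_smul_vecMulVec_mulVec b, dotProduct_single,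
    Pi.star_apply, hb, star_zero, zero_mul, mul_zero, zero_smul, sub_zero,
    one_sub_smul_vecMulVec_mulVec, dotProduct_single]
  simp [ha, hb]

theorem continuousOn_transport :
    ContinuousOn (fun p : (n → ℂ) × (n → ℂ) => transport p.1 p.2)
      {p | 1 + star p.1 ⬝ᵥ p.2 ≠ 0} := by
  refine ContinuousOn.mul (ContinuousOn.sub continuousOn_const (ContinuousOn.fun_smul ?_ ?_)) ?_
  · exact ContinuousOn.inv₀ (Continuous.continuousOn (by fun_prop)) fun p hp => hp
  · exact Continuous.continuousOn (by fun_prop)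
  · exact Continuous.continuousOn (by fun_prop)

end Matrix

end Transport

section ColumnHomotopy

namespace Matrix

open scoped unitInterval

variable {n : ℕ}

/-- The last columns of the special unitary matrix `A`, from the index `m` on, are those of the
identity matrix. -/
def FixesFrom (m : ℕ) (A : specialUnitaryGroup (Fin n) ℂ) : Prop :=
  ∀ j : Fin n, m ≤ j → (A : Matrix (Fin n) (Fin n) ℂ) *ᵥ Pi.single j 1 = Pi.single j 1

theorem star_mulVec_dotProduct_mulVec {A : Matrix (Fin n) (Fin n) ℂ}
    (hA : A ∈ unitaryGroup (Fin n) ℂ) (v w : Fin n → ℂ) :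
    star (A *ᵥ v) ⬝ᵥ (A *ᵥ w) = star v ⬝ᵥ w := by
  rw [star_mulVec, dotProduct_mulVec, vecMul_vecMul, ← star_eq_conjTranspose,
    mem_unitaryGroup_iff'.mp hA, ← dotProduct_mulVec, one_mulVec]

theorem FixesFrom.mulVec_single_apply {m : ℕ} {A : specialUnitaryGroup (Fin n) ℂ}
    (hA : FixesFrom m A) {i j : Fin n} (hi : (i : ℕ) < m) (hj : m ≤ j) :
    ((A : Matrix (Fin n) (Fin n) ℂ) *ᵥ Pi.single i 1) j = 0 := by
  have h := star_mulVec_dotProduct_mulVec A.2.1 (Pi.single j 1) (Pi.single i 1)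
  have hij : j ≠ i := fun h => by omega
  rw [hA j hj, Pi.star_single, star_one, single_dotProduct, single_dotProduct, one_mul, one_mul,
    Pi.single_eq_of_ne hij] at h
  exact h

theorem star_mulVec_single_dotProduct_self (A : specialUnitaryGroup (Fin n) ℂ) (i : Fin n) :
    star ((A : Matrix (Fin n) (Fin n) ℂ) *ᵥ Pi.single i 1) ⬝ᵥ
      ((A : Matrix (Fin n) (Fin n) ℂ) *ᵥ Pi.single i 1) = 1 := by
  rw [star_mulVec_dotProduct_mulVec A.2.1]
  simp

/-- Change the matrix `A`, whose column of some index is `b`, so that this column becomes `a`; the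
column of index `i` takes care of the determinant. -/
noncomputable def moveColumn (i : Fin n) (a b : Fin n → ℂ) (A : Matrix (Fin n) (Fin n) ℂ) :
    Matrix (Fin n) (Fin n) ℂ :=
  transport a b * A * diagonal (Function.update 1 i (star (transport a b).det))

theorem moveColumn_mem {i : Fin n} {a b : Fin n → ℂ} {A : Matrix (Fin n) (Fin n) ℂ}
    (hA : A ∈ specialUnitaryGroup (Fin n) ℂ) (hT : transport a b ∈ unitaryGroup (Fin n) ℂ) :
    moveColumn i a b A ∈ specialUnitaryGroup (Fin n) ℂ := by
  have hdet := det_of_mem_unitary hT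
  have hd : star (transport a b).det * (transport a b).det = 1 := hdet.1
  have hd' : (transport a b).det * star (transport a b).det = 1 := hdet.2
  refine mem_specialUnitaryGroup_iff.mpr ⟨mul_mem (mul_mem hT hA.1) ?_, ?_⟩
  · rw [mem_unitaryGroup_iff, star_eq_conjTranspose, diagonal_conjTranspose, diagonal_mul_diagonal,
      ← diagonal_one]
    congr 1
    ext k
    rcases eq_or_ne k i with rfl | hk
    · simpa using hd
    · simp [hk]
  · rw [moveColumn, det_mul, det_mul, det_diagonal, Finset.prod_update_of_mem (Finset.mem_univ i),
      (mem_specialUnitaryGroup_iff.mp hA).2]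
    simpa using hd'

theorem moveColumn_mulVec_single {i j : Fin n} (hij : j ≠ i) (a b : Fin n → ℂ)
    (A : Matrix (Fin n) (Fin n) ℂ) :
    moveColumn i a b A *ᵥ Pi.single j 1 = transport a b *ᵥ (A *ᵥ Pi.single j 1) := by
  rw [moveColumn, ← mulVec_mulVec, ← mulVec_mulVec]
  congr 2
  ext k
  rw [mulVec_diagonal]
  rcases eq_or_ne k j with rfl | hk
  · simp [hij]
  · simp [hk]

theorem moveColumn_self {i : Fin n} {b : Fin n → ℂ} (hb : star b ⬝ᵥ b = 1)
    (A : Matrix (Fin n) (Fin n) ℂ) : moveColumn i b b A = A := by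
  simp [moveColumn, transport_self hb]

theorem exists_homotopicRel_of_line {K : Type*} [TopologicalSpace K] {B : Set K}
    (f : C(K, specialUnitaryGroup (Fin n) ℂ)) {i m : Fin n} (him : i < m)
    (hf : ∀ x, FixesFrom (m + 1) (f x)) (b : C(K, Fin n → ℂ))
    (hb : ∀ x, ∀ j, m < j → b x j = 0)
    (hbB : ∀ x ∈ B, b x = (f x : Matrix (Fin n) (Fin n) ℂ) *ᵥ Pi.single m 1)
    (hline : ∀ x, ∀ t ∈ I, ((1 - t : ℝ) : ℂ) •
      ((f x : Matrix (Fin n) (Fin n) ℂ) *ᵥ Pi.single m 1) + (t : ℂ) • b x ≠ 0) :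
    ∃ g : C(K, specialUnitaryGroup (Fin n) ℂ), f.HomotopicRel g B ∧
      (∀ x, FixesFrom (m + 1) (g x)) ∧
      ∀ x, (g x : Matrix (Fin n) (Fin n) ℂ) *ᵥ Pi.single m 1 = unitVec (b x) := by
  set q : K → Fin n → ℂ := fun x => (f x : Matrix (Fin n) (Fin n) ℂ) *ᵥ Pi.single m 1 with hq
  have hqc : Continuous q := by fun_prop
  set l : I × K → Fin n → ℂ := fun z => ((1 - z.1 : ℝ) : ℂ) • q z.2 + ((z.1 : ℝ) : ℂ) • b z.2
    with hl
  have hlc : Continuous l := by fun_prop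
  have hl0 : ∀ z, l z ≠ 0 := fun z => hline z.2 z.1 z.1.2
  have hq1 : ∀ x, star (q x) ⬝ᵥ q x = 1 := fun x => star_mulVec_single_dotProduct_self (f x) m
  have huc : Continuous fun z => unitVec (l z) := continuousOn_unitVec.comp_continuous hlc hl0
  have hu1 : ∀ z, star (unitVec (l z)) ⬝ᵥ unitVec (l z) = 1 := fun z =>
    star_dotProduct_unitVec (hl0 z)
  have huq : ∀ z : I × K, 1 + star (unitVec (l z)) ⬝ᵥ q z.2 ≠ 0 := by
    rintro ⟨t, x⟩
    refine one_add_star_dotProduct_ne_zero (hu1 _) (hq1 _) fun h => ?_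
    obtain ⟨r, hr, hrl⟩ := exists_unitVec_eq (hl0 (t, x))
    rw [hrl] at h
    have hr1 : 0 < r + 1 := by linarith
    refine hline x (r * t / (r + 1)) ⟨by have := t.2.1; positivity, ?_⟩ ?_
    · rw [div_le_one hr1]
      have := t.2.2
      nlinarith
    · have e : ((1 - r * t / (r + 1) : ℝ) : ℂ) • q x + ((r * t / (r + 1) : ℝ) : ℂ) • b x =
          ((1 / (r + 1) : ℝ) : ℂ) • ((r : ℂ) • l (t, x) + q x) := by
        have hr1' : (r : ℂ) + 1 ≠ 0 := by exact_mod_cast hr1.ne'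
        ext k
        simp [hl]
        field_simp
        ring
      rw [e, h, smul_zero]
  have hTmem : ∀ z : I × K, transport (unitVec (l z)) (q z.2) ∈ unitaryGroup (Fin n) ℂ := fun z =>
    transport_mem_unitaryGroup (hu1 _) (hq1 _) (huq z)
  have hTc : Continuous fun z : I × K => transport (unitVec (l z)) (q z.2) :=
    continuousOn_transport.comp_continuous
      (f := fun z : I × K => (unitVec (l z), q z.2)) (huc.prodMk (hqc.comp continuous_snd)) huq
  set H : I × K → Matrix (Fin n) (Fin n) ℂ :=
    fun z => moveColumn i (unitVec (l z)) (q z.2) (f z.2) with hH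
  have hHc : Continuous H := by
    refine (hTc.mul (by fun_prop)).mul (Continuous.matrix_diagonal ?_)
    exact continuous_const.update i (hTc.matrix_det.star)
  have hHmem : ∀ z, H z ∈ specialUnitaryGroup (Fin n) ℂ := fun z =>
    moveColumn_mem (f z.2).2 (hTmem z)
  have hstay : ∀ z : I × K, l z = q z.2 → H z = f z.2 := by
    intro z hz
    simp only [hH]
    rw [hz, unitVec_of_unit (hq1 _), moveColumn_self (hq1 _)]
  have hl1 : ∀ x, l (1, x) = b x := fun x => by simp [hl]
  refine ⟨⟨fun x => ⟨H (1, x), hHmem _⟩, by fun_prop⟩,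
    ⟨⟨⟨⟨fun z => ⟨H z, hHmem z⟩, by fun_prop⟩, fun x => ?_, fun x => rfl⟩, ?_⟩⟩, ?_, ?_⟩
  · exact Subtype.ext (hstay (0, x) (by simp [hl]))
  · intro t x hx
    refine Subtype.ext (hstay (t, x) ?_)
    simp only [hl, hbB x hx]
    rw [← add_smul]
    simp
  · intro x j hj
    have hmj : m < j := by rw [Fin.lt_def]; omega
    show H (1, x) *ᵥ _ = _
    simp only [hH]
    rw [moveColumn_mulVec_single (him.trans hmj).ne', hf x j hj, hl1]
    refine transport_mulVec_single ?_ ?_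
    · simp [unitVec, hb x j hmj]
    · exact (hf x).mulVec_single_apply (Nat.lt_succ_self m) hj
  · intro x
    show H (1, x) *ᵥ _ = _
    simp only [hH]
    rw [moveColumn_mulVec_single him.ne']
    refine (transport_mulVec (hq1 x) (huq (1, x))).trans ?_
    rw [hl1]

end Matrix

end ColumnHomotopy

section KillColumns

open Module

/-- A map from a retract of a normed space to a normed space of larger dimension can be slightly
moved off the origin. -/
theorem exists_approx_ne_zero {K W F : Type*} [TopologicalSpace K] [NormedAddCommGroup W]
    [NormedSpace ℝ W] [FiniteDimensional ℝ W] [NormedAddCommGroup F] [NormedSpace ℝ F]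
    [FiniteDimensional ℝ F] (hWF : finrank ℝ W < finrank ℝ F) {ι : K → W} {r : W → K}
    (hι : Continuous ι) (hr : Continuous r) (hrι : Function.LeftInverse r ι) {ξ : K → F}
    (hξ : Continuous ξ) {ε : ℝ} (hε : 0 < ε) :
    ∃ p : K → F, Continuous p ∧ (∀ x, p x ≠ 0) ∧ ∀ x, ‖p x - ξ x‖ < ε := by
  obtain ⟨g, hg, hgξ, -⟩ := Continuous.exists_contDiff_approx (f := ξ ∘ r) (ε := fun _ => ε / 2) 1
    (hξ.comp hr) continuous_const fun _ => half_pos hε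
  obtain ⟨v, hv, hvε⟩ := (hg.dense_compl_range_of_finrank_lt_finrank hWF).exists_dist_lt 0
    (half_pos hε)
  rw [dist_zero_left] at hvε
  refine ⟨fun x => g (ι x) - v, (hg.continuous.comp hι).sub continuous_const,
    fun x h => hv ⟨ι x, sub_eq_zero.mp h⟩, fun x => ?_⟩
  have h := hgξ (ι x)
  rw [dist_eq_norm, Function.comp_apply, hrι x] at h
  calc ‖g (ι x) - v - ξ x‖ = ‖(g (ι x) - ξ x) - v‖ := by congr 1; abel
    _ ≤ ‖g (ι x) - ξ x‖ + ‖v‖ := norm_sub_le _ _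
    _ < ε := by linarith

namespace Matrix

variable {n : ℕ}

theorem norm_mulVec_single_apply_le_one (A : specialUnitaryGroup (Fin n) ℂ) (i j : Fin n) :
    ‖((A : Matrix (Fin n) (Fin n) ℂ) *ᵥ Pi.single i 1) j‖ ≤ 1 := by
  rw [mulVec_single_one]
  exact entry_norm_bound_of_unitary A.2.1 j i

/-- A family of special unitary matrices fixing the basis vectors `e j` for `m < j`, parametrized by
a space of dimension at most four, can be deformed so that it also fixes `e m`. -/
theorem exists_homotopicRel_fixesFrom {K W : Type*} [TopologicalSpace K] [NormedAddCommGroup W]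
    [NormedSpace ℝ W] [FiniteDimensional ℝ W] (hW : finrank ℝ W < 5) {ι : K → W} {r : W → K}
    (hι : Continuous ι) (hr : Continuous r) (hrι : Function.LeftInverse r ι) {B : Set K}
    (f : C(K, specialUnitaryGroup (Fin n) ℂ)) {m : ℕ} (hm : 2 ≤ m)
    (hf : ∀ x, FixesFrom (m + 1) (f x)) (hB : ∀ x ∈ B, FixesFrom m (f x)) :
    ∃ g : C(K, specialUnitaryGroup (Fin n) ℂ), f.HomotopicRel g B ∧ ∀ x, FixesFrom m (g x) := by
  rcases le_or_gt n m with hnm | hmn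
  · exact ⟨f, ContinuousMap.HomotopicRel.refl f, fun x j hj => by omega⟩
  obtain ⟨i₀, h₀⟩ : ∃ i : Fin n, (i : ℕ) = 0 := ⟨⟨0, by omega⟩, rfl⟩
  obtain ⟨i₁, h₁⟩ : ∃ i : Fin n, (i : ℕ) = 1 := ⟨⟨1, by omega⟩, rfl⟩
  lift m to Fin n using hmn
  have h₀₁ : i₀ ≠ i₁ := fun h => by rw [h] at h₀; omega
  have h₀m : i₀ < m := by rw [Fin.lt_def]; omega
  have h₁m : i₁ < m := by rw [Fin.lt_def]; omega
  set q : K → Fin n → ℂ := fun x => (f x : Matrix (Fin n) (Fin n) ℂ) *ᵥ Pi.single m 1 with hq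
  have hqc : Continuous q := by fun_prop
  obtain ⟨p, hpc, hp0, hpq⟩ := exists_approx_ne_zero (F := ℂ × ℂ × ℝ)
    (ξ := fun x => (q x i₀, q x i₁, (q x m).im)) (ε := 1 / 4)
    (by simpa [Complex.finrank_real_complex] using hW) hι hr hrι (by fun_prop) (by norm_num)
  set μ : K → ℝ := fun x => min 1 (1 - (q x m).re) with hμ
  have hμc : Continuous μ := by fun_prop
  have hq1 : ∀ x k, ‖q x k‖ ≤ 1 := fun x k => norm_mulVec_single_apply_le_one (f x) m k
  have hμ1 : ∀ x, μ x ≤ 1 := fun x => min_le_left _ _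
  have hμ0 : ∀ x, 0 ≤ μ x := fun x =>
    le_min zero_le_one (by linarith [Complex.re_le_norm (q x m), hq1 x m])
  set δ : K → Fin n → ℂ := fun x => Pi.single i₀ ((p x).1 - q x i₀) +
    Pi.single i₁ ((p x).2.1 - q x i₁) + Pi.single m ((((p x).2.2 - (q x m).im : ℝ) : ℂ) * Complex.I)
    with hδ
  have hδc : Continuous δ := by
    refine ((?_ : Continuous _).add ?_).add ?_ <;> refine continuous_pi fun k => ?_
    · exact (continuous_apply k).comp ((continuous_single i₀).comp (by fun_prop))
    · exact (continuous_apply k).comp ((continuous_single i₁).comp (by fun_prop))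
    · exact (continuous_apply k).comp ((continuous_single m).comp (by fun_prop))
  have hδ₀ : ∀ x, δ x i₀ = (p x).1 - q x i₀ := fun x => by simp [hδ, h₀₁, h₀m.ne]
  have hδ₁ : ∀ x, δ x i₁ = (p x).2.1 - q x i₁ := fun x => by simp [hδ, h₀₁.symm, h₁m.ne]
  have hδm : ∀ x, δ x m = (((p x).2.2 - (q x m).im : ℝ) : ℂ) * Complex.I := fun x => by
    simp [hδ, h₀m.ne', h₁m.ne']
  set b : C(K, Fin n → ℂ) := ⟨fun x => q x + (μ x : ℂ) • δ x, by fun_prop⟩ with hb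
  have hbm : ∀ x, ∀ j, m < j → b x j = 0 := fun x j hj => by
    have h : q x j = 0 := (hf x).mulVec_single_apply (Nat.lt_succ_self m) hj
    simp [hb, hδ, h, (h₀m.trans hj).ne', (h₁m.trans hj).ne', hj.ne']
  have hbB : ∀ x ∈ B, b x = q x := fun x hx => by
    have h : q x = Pi.single m 1 := hB x hx m le_rfl
    simp [hb, hμ, h]
  have hqB : ∀ x ∈ B, q x = Pi.single m 1 := fun x hx => hB x hx m le_rfl
  have hline : ∀ x, ∀ t ∈ unitInterval, ((1 - t : ℝ) : ℂ) • q x + (t : ℂ) • b x ≠ 0 := by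
    intro x t ht h
    have hs : ((1 - t : ℝ) : ℂ) • q x + (t : ℂ) • b x = q x + ((t * μ x : ℝ) : ℂ) • δ x := by
      ext k
      simp [hb]
      ring
    rw [hs] at h
    set s := t * μ x
    have hs0 : 0 ≤ s := mul_nonneg ht.1 (hμ0 x)
    have hs1 : s ≤ 1 := mul_le_one₀ ht.2 (hμ0 x) (hμ1 x)
    have hself : star (q x) ⬝ᵥ q x = 1 := star_mulVec_single_dotProduct_self (f x) m
    have e : (1 : ℂ) = -(s : ℂ) * (star (q x) ⬝ᵥ δ x) := by
      rw [← hself, ← smul_eq_mul, ← dotProduct_smul]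
      congr 1
      rw [neg_smul]
      exact eq_neg_of_add_eq_zero_left h
    simp only [hδ, dotProduct_add, dotProduct_single] at e
    have hpx := hpq x
    simp only [Prod.norm_def, Prod.fst_sub, Prod.snd_sub, max_lt_iff] at hpx
    obtain ⟨e₀, e₁, e₂⟩ := hpx
    have key : ∀ k (z : ℂ), ‖z‖ < 1 / 4 → ‖star (q x) k * z‖ ≤ 1 / 4 := fun k z hz => by
      rw [norm_mul, Pi.star_apply, norm_star]
      exact (mul_le_of_le_one_left (norm_nonneg z) (hq1 x k)).trans hz.le
    have e₂' : ‖(((p x).2.2 - (q x m).im : ℝ) : ℂ) * Complex.I‖ < 1 / 4 := by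
      simpa only [norm_mul, Complex.norm_I, mul_one, Complex.norm_real] using e₂
    have hn := congrArg norm e
    rw [norm_one, norm_mul, norm_neg, Complex.norm_real, Real.norm_of_nonneg hs0] at hn
    have := norm_add₃_le (a := star (q x) i₀ * ((p x).1 - q x i₀))
      (b := star (q x) i₁ * ((p x).2.1 - q x i₁))
      (c := star (q x) m * ((((p x).2.2 - (q x m).im : ℝ) : ℂ) * Complex.I))
    have := key i₀ _ e₀
    have := key i₁ _ e₁
    have := key m _ e₂'
    have := mul_le_of_le_one_left (norm_nonneg (star (q x) i₀ * ((p x).1 - q x i₀) +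
      star (q x) i₁ * ((p x).2.1 - q x i₁) +
      star (q x) m * ((((p x).2.2 - (q x m).im : ℝ) : ℂ) * Complex.I))) hs1
    linarith
  obtain ⟨f', hff', hf', hf'b⟩ := exists_homotopicRel_of_line (B := B) f h₀m hf b hbm hbB hline
  have hb0 : ∀ x, b x ≠ 0 := fun x h => hline x 1 ⟨zero_le_one, le_rfl⟩ (by simp [h])
  obtain ⟨g, hg, hgf, hgm⟩ := exists_homotopicRel_of_line (B := B) f' h₀m hf'
    (ContinuousMap.const K (Pi.single m 1)) (fun x j hj => by simp [hj.ne'])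
    (fun x hx => by
      rw [hf'b, hbB x hx, ContinuousMap.const_apply, hqB x hx, unitVec_of_unit]
      simp)
    (fun x t ht h => by
      obtain ⟨c, hc, hcb⟩ := exists_unitVec_eq (hb0 x)
      rw [hf'b, hcb] at h
      have hk : ∀ k, (1 - t : ℂ) * (c * b x k) + t * (Pi.single m (1 : ℂ) : Fin n → ℂ) k = 0 :=
        fun k => by simpa using congrFun h k
      rcases eq_or_ne t 1 with rfl | ht1
      · simpa using hk m
      have hct : (1 - t) * c ≠ 0 := mul_ne_zero (sub_ne_zero.mpr ht1.symm) hc.ne'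
      have hct' : (1 - t : ℂ) * c ≠ 0 := by exact_mod_cast hct
      have hb₀ : b x i₀ = 0 := by
        have := hk i₀
        rw [Pi.single_eq_of_ne h₀m.ne, mul_zero, add_zero, ← mul_assoc] at this
        exact (mul_eq_zero.mp this).resolve_left hct'
      have hb₁ : b x i₁ = 0 := by
        have := hk i₁
        rw [Pi.single_eq_of_ne h₁m.ne, mul_zero, add_zero, ← mul_assoc] at this
        exact (mul_eq_zero.mp this).resolve_left hct'
      have hbe : b x m = (((-t) / ((1 - t) * c) : ℝ) : ℂ) := by
        have := hk m
        rw [Pi.single_eq_same] at this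
        push_cast
        rw [eq_div_iff hct']
        linear_combination this
      have hbm' : b x m = q x m + μ x * δ x m := rfl
      have hre := congrArg Complex.re hbe
      have him := congrArg Complex.im hbe
      rw [hbm', hδm, Complex.ofReal_re] at hre
      rw [hbm', hδm, Complex.ofReal_im] at him
      simp only [Complex.add_re, Complex.add_im, Complex.mul_re, Complex.mul_im, Complex.ofReal_re,
        Complex.ofReal_im, Complex.I_re, Complex.I_im, mul_zero, zero_mul, sub_zero, add_zero,
        mul_one] at hre him
      have hneg : (q x m).re ≤ 0 := by
        rw [hre]
        exact div_nonpos_of_nonpos_of_nonneg (by linarith [ht.1])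
          (mul_nonneg (by linarith [ht.2]) hc.le)
      have hμx : μ x = 1 := min_eq_left (by linarith)
      rw [hμx] at him
      have hb₀' : b x i₀ = q x i₀ + μ x * δ x i₀ := rfl
      have hb₁' : b x i₁ = q x i₁ + μ x * δ x i₁ := rfl
      rw [hb₀', hδ₀, hμx] at hb₀
      rw [hb₁', hδ₁, hμx] at hb₁
      refine hp0 x (Prod.ext ?_ (Prod.ext ?_ ?_))
      · simpa using hb₀
      · simpa using hb₁
      · simpa using him)
  refine ⟨g, hff'.trans hg, fun x j hj => ?_⟩
  rcases hj.eq_or_lt with h | h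
  · obtain rfl : m = j := Fin.ext h
    rw [hgm, ContinuousMap.const_apply, unitVec_of_unit]
    simp
  · exact hgf x j h

/-- Iterating `exists_homotopicRel_fixesFrom`, only a block of size two survives. -/
theorem exists_homotopicRel_fixesFrom_two {K W : Type*} [TopologicalSpace K] [NormedAddCommGroup W]
    [NormedSpace ℝ W] [FiniteDimensional ℝ W] (hW : finrank ℝ W < 5) {ι : K → W} {r : W → K}
    (hι : Continuous ι) (hr : Continuous r) (hrι : Function.LeftInverse r ι) {B : Set K}
    (f : C(K, specialUnitaryGroup (Fin n) ℂ)) (hB : ∀ x ∈ B, FixesFrom 2 (f x)) :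
    ∃ g : C(K, specialUnitaryGroup (Fin n) ℂ), f.HomotopicRel g B ∧ ∀ x, FixesFrom 2 (g x) := by
  suffices h : ∀ k : ℕ, k ≤ n → ∃ g : C(K, specialUnitaryGroup (Fin n) ℂ),
      f.HomotopicRel g B ∧ ∀ x, FixesFrom (2 + (n - k)) (g x) by
    simpa using h n le_rfl
  intro k
  induction k with
  | zero => exact fun _ => ⟨f, ContinuousMap.HomotopicRel.refl f, fun x j hj => by omega⟩
  | succ k ih =>
    intro hk
    obtain ⟨g, hfg, hg⟩ := ih (by omega)
    have hgB : ∀ x ∈ B, FixesFrom 2 (g x) := fun x hx => by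
      obtain ⟨F⟩ := hfg
      rw [← F.fst_eq_snd hx]
      exact hB x hx
    obtain ⟨g', hgg', hg'⟩ := exists_homotopicRel_fixesFrom (m := 2 + (n - (k + 1))) hW hι hr hrι
      (B := B) g (by omega) (fun x => by
        have := hg x
        rwa [show 2 + (n - k) = 2 + (n - (k + 1)) + 1 by omega] at this)
      (fun x hx j hj => hgB x hx j (by omega))
    exact ⟨g', hfg.trans hgg', hg'⟩

end Matrix

end KillColumns

section QuaternionBlock

namespace Matrix

open Complex

/-- The squared Euclidean norm on `ℝ³ × ℝ`. -/
def sqNorm (v : (Fin 3 → ℝ) × ℝ) : ℝ := v.1 0 ^ 2 + v.1 1 ^ 2 + v.1 2 ^ 2 + v.2 ^ 2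

theorem continuous_sqNorm : Continuous sqNorm := by
  unfold sqNorm
  fun_prop

theorem sqNorm_pos {v : (Fin 3 → ℝ) × ℝ} (hv : v ≠ 0) : 0 < sqNorm v := by
  unfold sqNorm
  by_contra! h
  refine hv (Prod.ext (funext fun i => ?_) ?_)
  · fin_cases i <;> exact pow_eq_zero_iff two_ne_zero |>.mp <| le_antisymm
      (by dsimp; nlinarith [sq_nonneg (v.1 0), sq_nonneg (v.1 1), sq_nonneg (v.1 2),
        sq_nonneg v.2]) (sq_nonneg _)
  · exact pow_eq_zero_iff two_ne_zero |>.mp <| le_antisymm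
      (by nlinarith [sq_nonneg (v.1 0), sq_nonneg (v.1 1), sq_nonneg (v.1 2),
        sq_nonneg v.2]) (sq_nonneg _)

/-- The quaternion with the given coordinates, as a complex matrix of size two. -/
def quat (v : (Fin 3 → ℝ) × ℝ) : Matrix (Fin 2) (Fin 2) ℂ :=
  !![v.2 - v.1 2 * I, v.1 0 + v.1 1 * I; -(v.1 0 - v.1 1 * I), v.2 + v.1 2 * I]

theorem continuous_quat : Continuous quat := by
  refine continuous_matrix fun i j => ?_
  fin_cases i <;> fin_cases j <;> simp [quat] <;> fun_prop

theorem quat_mul_star (v : (Fin 3 → ℝ) × ℝ) : quat v * star (quat v) = (sqNorm v : ℂ) • 1 := by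
  ext i j
  fin_cases i <;> fin_cases j <;>
    simp [quat, sqNorm, Matrix.mul_apply, Fin.sum_univ_two, star_eq_conjTranspose] <;>
    ring_nf <;> simp <;> ring

theorem det_quat (v : (Fin 3 → ℝ) × ℝ) : (quat v).det = sqNorm v := by
  simp [quat, sqNorm, det_fin_two]
  ring_nf
  simp
  ring

theorem smul_quat_mem {v : (Fin 3 → ℝ) × ℝ} (hv : v ≠ 0) :
    (((√(sqNorm v))⁻¹ : ℝ) : ℂ) • quat v ∈ specialUnitaryGroup (Fin 2) ℂ := by
  have h := sqNorm_pos hv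
  have h2 : (√(sqNorm v))⁻¹ * (√(sqNorm v))⁻¹ * sqNorm v = 1 := by
    rw [← mul_inv, Real.mul_self_sqrt h.le, inv_mul_cancel₀ h.ne']
  have h3 : (((√(sqNorm v))⁻¹ : ℝ) : ℂ) * ((√(sqNorm v))⁻¹ : ℝ) * (sqNorm v : ℝ) = 1 := by
    exact_mod_cast h2
  refine mem_specialUnitaryGroup_iff.mpr ⟨?_, ?_⟩
  · rw [mem_unitaryGroup_iff, star_smul, smul_mul_smul_comm, quat_mul_star, smul_smul,
      RCLike.star_def, conj_ofReal, h3, one_smul]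
  · rw [det_smul, det_quat, Fintype.card_fin, pow_two, h3]

variable (N : ℕ)

/-- The embedding of matrices of size two as upper left corners of larger matrices. -/
def corner (A : Matrix (Fin 2) (Fin 2) ℂ) : Matrix (Fin (2 + N)) (Fin (2 + N)) ℂ :=
  (fromBlocks A 0 0 1).submatrix finSumFinEquiv.symm finSumFinEquiv.symm

theorem corner_mem {A : Matrix (Fin 2) (Fin 2) ℂ} (hA : A ∈ specialUnitaryGroup (Fin 2) ℂ) :
    corner N A ∈ specialUnitaryGroup (Fin (2 + N)) ℂ := by
  obtain ⟨hA1, hA2⟩ := mem_specialUnitaryGroup_iff.mp hA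
  refine mem_specialUnitaryGroup_iff.mpr ⟨?_, ?_⟩
  · rw [mem_unitaryGroup_iff, star_eq_conjTranspose] at *
    rw [corner, conjTranspose_submatrix, submatrix_mul_equiv, fromBlocks_conjTranspose,
      fromBlocks_multiply]
    simp [hA1]
  · rw [corner, det_submatrix_equiv_self, det_fromBlocks_zero₂₁, hA2, det_one, one_mul]

open scoped Classical in
/-- The radial extension to `ℝ⁴` of the inclusion of the unit quaternions into a special unitary
group. -/
noncomputable def quatSU (v : (Fin 3 → ℝ) × ℝ) : specialUnitaryGroup (Fin (2 + N)) ℂ :=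
  if hv : v = 0 then 1 else ⟨_, corner_mem N (smul_quat_mem hv)⟩

theorem coe_quatSU {v : (Fin 3 → ℝ) × ℝ} (hv : v ≠ 0) :
    (quatSU N v : Matrix (Fin (2 + N)) (Fin (2 + N)) ℂ) =
      corner N ((((√(sqNorm v))⁻¹ : ℝ) : ℂ) • quat v) := by
  rw [quatSU, dif_neg hv]

theorem continuousOn_quatSU : ContinuousOn (quatSU N) {v | v ≠ 0} := by
  refine Topology.IsInducing.subtypeVal.continuousOn_iff.mpr (ContinuousOn.congr ?_
    fun v hv => coe_quatSU N hv)
  have h : ContinuousOn (fun v => (((√(sqNorm v))⁻¹ : ℝ) : ℂ) • quat v) {v | v ≠ 0} := by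
    refine ContinuousOn.fun_smul (continuous_ofReal.comp_continuousOn ?_)
      continuous_quat.continuousOn
    exact ContinuousOn.inv₀ (continuous_sqNorm.sqrt.continuousOn) fun v hv =>
      (Real.sqrt_pos.mpr (sqNorm_pos hv)).ne'
  have hc : Continuous (corner N) := by
    unfold corner
    fun_prop
  exact hc.comp_continuousOn h

theorem quatSU_of_pos {s : ℝ} (hs : 0 < s) : quatSU N (0, s) = 1 := by
  have h0 : ((0 : Fin 3 → ℝ), s) ≠ 0 := fun h => hs.ne' (congrArg Prod.snd h)
  refine Subtype.ext ?_
  rw [coe_quatSU N h0]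
  have : (((√(sqNorm (0, s)))⁻¹ : ℝ) : ℂ) • quat (0, s) = 1 := by
    have h : √(sqNorm (0, s)) = s := by simp [sqNorm, Real.sqrt_sq hs.le]
    have hs' : (s : ℂ) ≠ 0 := by exact_mod_cast hs.ne'
    rw [h]
    ext i j
    fin_cases i <;> fin_cases j <;> simp [quat, hs']
  rw [this, corner, fromBlocks_one]
  simp

theorem fixesFrom_quatSU (v : (Fin 3 → ℝ) × ℝ) : FixesFrom 2 (quatSU N v) := by
  intro j hj
  rcases eq_or_ne v 0 with rfl | hv
  · rw [quatSU, dif_pos rfl]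
    exact one_mulVec _
  rw [coe_quatSU N hv, mulVec_single_one]
  induction j using Fin.addCases with
  | left i => simp at hj; omega
  | right k =>
    ext i
    induction i using Fin.addCases with
    | left i =>
      have : Fin.castAdd N i ≠ Fin.natAdd 2 k := fun h => by
        have := congrArg Fin.val h
        simp at this
        omega
      simp [corner, this]
    | right i => simp [corner, one_apply, Pi.single_apply]

variable {N}

/-- The coordinates in `ℝ⁴` of a unit quaternion, read off from a matrix. -/
def quatCoord (A : specialUnitaryGroup (Fin (2 + N)) ℂ) : (Fin 3 → ℝ) × ℝ :=
  (![(A.1 (Fin.castAdd N 0) (Fin.castAdd N 1)).re, (A.1 (Fin.castAdd N 0) (Fin.castAdd N 1)).im,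
    (A.1 (Fin.castAdd N 1) (Fin.castAdd N 1)).im], (A.1 (Fin.castAdd N 1) (Fin.castAdd N 1)).re)

theorem continuous_quatCoord :
    Continuous (quatCoord : specialUnitaryGroup (Fin (2 + N)) ℂ → (Fin 3 → ℝ) × ℝ) := by
  have h : ∀ i j, Continuous fun A : specialUnitaryGroup (Fin (2 + N)) ℂ => A.1 i j := fun i j =>
    continuous_subtype_val.matrix_elem i j
  refine Continuous.prodMk (continuous_pi fun i => ?_) (continuous_re.comp (h _ _))
  fin_cases i
  · exact continuous_re.comp (h _ _)
  · exact continuous_im.comp (h _ _)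
  · exact continuous_im.comp (h _ _)

theorem quatCoord_quatSU {v : (Fin 3 → ℝ) × ℝ} (hv : v ≠ 0) :
    quatCoord (quatSU N v) = (√(sqNorm v))⁻¹ • v := by
  unfold quatCoord
  rw [coe_quatSU N hv]
  refine Prod.ext (funext fun i => ?_) ?_
  · fin_cases i <;> simp [corner, quat]
  · simp [corner, quat]

theorem eq_one_of_fixesFrom_one {n : ℕ} {A : specialUnitaryGroup (Fin n) ℂ} (hA : FixesFrom 1 A) :
    A = 1 := by
  rcases Nat.eq_zero_or_pos n with rfl | hn
  · exact Subtype.ext (Subsingleton.elim _ _)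
  set i₀ : Fin n := ⟨0, hn⟩
  have h : (A : Matrix (Fin n) (Fin n) ℂ) = diagonal (Function.update 1 i₀ (A.1 i₀ i₀)) := by
    ext i j
    rcases eq_or_ne j i₀ with rfl | hj
    · rcases eq_or_ne i i₀ with rfl | hi
      · simp
      · have hi' : 1 ≤ (i : ℕ) := Nat.one_le_iff_ne_zero.mpr fun h => hi (Fin.ext h)
        have := hA.mulVec_single_apply (i := i₀) Nat.zero_lt_one hi'
        rw [mulVec_single_one] at this
        rw [diagonal_apply_ne _ hi]
        exact this
    · have := congrFun (hA j (Nat.one_le_iff_ne_zero.mpr fun h => hj (Fin.ext h))) i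
      rw [mulVec_single_one] at this
      refine Eq.trans this ?_
      rcases eq_or_ne i j with rfl | hij
      · simp [hj]
      · rw [diagonal_apply_ne _ hij, Pi.single_eq_of_ne hij]
  have hd := (mem_specialUnitaryGroup_iff.mp A.2).2
  rw [h, det_diagonal, Finset.prod_update_of_mem (Finset.mem_univ i₀)] at hd
  refine Subtype.ext (h.trans ?_)
  have : A.1 i₀ i₀ = 1 := by simpa using hd
  rw [this]
  simp

theorem sqNorm_quatCoord {A : specialUnitaryGroup (Fin (2 + N)) ℂ} (hA : FixesFrom 2 A) :
    sqNorm (quatCoord A) = 1 := by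
  have h := star_mulVec_single_dotProduct_self A (Fin.castAdd N 1)
  have h0 : ∀ k : Fin N, A.1 (Fin.natAdd 2 k) (Fin.castAdd N 1) = 0 := fun k => by
    have := hA.mulVec_single_apply (i := Fin.castAdd N 1) (j := Fin.natAdd 2 k) (by simp) (by simp)
    rwa [mulVec_single_one] at this
  rw [mulVec_single_one, dotProduct, Fin.sum_univ_add, Fin.sum_univ_two] at h
  simp only [Pi.star_apply, col_apply, h0, RCLike.star_def, mul_zero, Finset.sum_const_zero,
    add_zero] at h
  rw [← normSq_eq_conj_mul_self, ← normSq_eq_conj_mul_self, normSq_apply, normSq_apply] at h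
  norm_cast at h
  simp only [sqNorm, quatCoord]
  simp
  linarith

theorem quatSU_quatCoord {A : specialUnitaryGroup (Fin (2 + N)) ℂ} (hA : FixesFrom 2 A) :
    quatSU N (quatCoord A) = A := by
  have hs := sqNorm_quatCoord hA
  have hv : quatCoord A ≠ 0 := fun h => by rw [h] at hs; simp [sqNorm] at hs
  set A' := quatSU N (quatCoord A)
  have hA' : FixesFrom 2 A' := fixesFrom_quatSU N _
  have hcol : (A' : Matrix (Fin (2 + N)) (Fin (2 + N)) ℂ) *ᵥ Pi.single (Fin.castAdd N 1) 1 =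
      (A : Matrix (Fin (2 + N)) (Fin (2 + N)) ℂ) *ᵥ Pi.single (Fin.castAdd N 1) 1 := by
    have hc : quatCoord A' = quatCoord A := by
      rw [quatCoord_quatSU hv, hs, Real.sqrt_one, inv_one, one_smul]
    ext i
    induction i using Fin.addCases with
    | right k =>
      rw [hA.mulVec_single_apply (by simp) (by simp), hA'.mulVec_single_apply (by simp) (by simp)]
    | left k =>
      rw [mulVec_single_one, mulVec_single_one]
      have h0 := congrFun (congrArg Prod.fst hc) 0
      have h1 := congrFun (congrArg Prod.fst hc) 1
      have h2 := congrFun (congrArg Prod.fst hc) 2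
      have h3 := congrArg Prod.snd hc
      fin_cases k
      · exact Complex.ext h0 h1
      · exact Complex.ext h3 h2
  have hinv : ∀ j : Fin (2 + N), 1 ≤ (j : ℕ) → (A'⁻¹ * A).1 *ᵥ Pi.single j 1 = Pi.single j 1 := by
    intro j hj
    have hjA : A.1 *ᵥ Pi.single j 1 = A'.1 *ᵥ Pi.single j 1 := by
      rcases hj.eq_or_lt with h | h
      · obtain rfl : Fin.castAdd N 1 = j := Fin.ext h
        exact hcol.symm
      · rw [hA j h, hA' j h]
    have h1 : (A'⁻¹).1 * A'.1 = 1 :=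
      congrArg Subtype.val (inv_mul_cancel A')
    rw [Submonoid.coe_mul, ← mulVec_mulVec, hjA, mulVec_mulVec, h1, one_mulVec]
  exact (inv_mul_eq_one.mp (eq_one_of_fixesFrom_one hinv))

end Matrix

end QuaternionBlock

section LocalLoops

namespace Matrix

open scoped Topology.Homotopy unitInterval

/-- A map of degree one from `ℝ³` to the nonzero vectors of `ℝ⁴`, constant off the unit ball. -/
noncomputable def bubble (y : Fin 3 → ℝ) : (Fin 3 → ℝ) × ℝ :=
  (min 1 (2 * max 0 (1 - ‖y‖)) • y, min 1 (2 * ‖y‖ - 1))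

theorem continuous_bubble : Continuous bubble := by
  unfold bubble
  fun_prop

theorem bubble_of_one_le {y : Fin 3 → ℝ} (hy : 1 ≤ ‖y‖) : bubble y = (0, 1) := by
  unfold bubble
  rw [max_eq_left (by linarith), min_eq_left (a := (1 : ℝ)) (b := 2 * ‖y‖ - 1) (by linarith)]
  simp

theorem bubble_of_le_half {y : Fin 3 → ℝ} (hy : ‖y‖ ≤ 1 / 2) : bubble y = (y, 2 * ‖y‖ - 1) := by
  unfold bubble
  rw [max_eq_right (by linarith), min_eq_left (by linarith), min_eq_right (by linarith), one_smul]

theorem half_le_of_bubble_snd_nonneg {y : Fin 3 → ℝ} (hy : 0 ≤ (bubble y).2) : 1 / 2 ≤ ‖y‖ := by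
  by_contra! h
  rw [bubble_of_le_half h.le] at hy
  dsimp at hy
  linarith

theorem bubble_snd_pos {y : Fin 3 → ℝ} (hy : 1 / 2 < ‖y‖) : 0 < (bubble y).2 :=
  lt_min zero_lt_one (by linarith)

theorem bubble_ne_zero (y : Fin 3 → ℝ) : bubble y ≠ 0 := by
  intro h
  have h1 := half_le_of_bubble_snd_nonneg (y := y) (by rw [h]; exact le_rfl)
  rcases h1.eq_or_lt with h2 | h2
  · rw [bubble_of_le_half h2.ge] at h
    have : y = 0 := congrArg Prod.fst h
    rw [this, norm_zero] at h2
    norm_num at h2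
  · exact (bubble_snd_pos h2).ne' (congrArg Prod.snd h)

variable (N : ℕ)

/-- The generator of the third homotopy group of a special unitary group, as a map on `ℝ³`. -/
noncomputable def bubbleSU (y : Fin 3 → ℝ) : specialUnitaryGroup (Fin (2 + N)) ℂ :=
  quatSU N (bubble y)

theorem continuous_bubbleSU : Continuous (bubbleSU N) :=
  (continuousOn_quatSU N).comp_continuous continuous_bubble bubble_ne_zero

theorem bubbleSU_of_one_le {y : Fin 3 → ℝ} (hy : 1 ≤ ‖y‖) : bubbleSU N y = 1 := by
  rw [bubbleSU, bubble_of_one_le hy, quatSU_of_pos N one_pos]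

open scoped Classical in
theorem continuous_piecewise_bubbleSU {T : Type*} [TopologicalSpace T] {Z : Set T}
    {p : T → Fin 3 → ℝ} (hp : Continuous p) (hZ : ∀ x ∈ frontier Z, 1 ≤ ‖p x‖) :
    Continuous fun x => if x ∈ Z then bubbleSU N (p x) else 1 :=
  Continuous.if (fun x hx => bubbleSU_of_one_le N (hZ x hx)) ((continuous_bubbleSU N).comp hp)
    continuous_const

/-- The condition under which `p` and `Z` define a loop through `localLoop`. -/
structure IsLocal (Z : Set (I^Fin 3)) (p : (I^Fin 3) → Fin 3 → ℝ) : Prop where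
  continuous : Continuous p
  frontier : ∀ x ∈ frontier Z, 1 ≤ ‖p x‖
  boundary : ∀ x ∈ Cube.boundary (Fin 3), x ∈ Z → 1 ≤ ‖p x‖

open scoped Classical in
/-- The loop which is the bubble over the map `p` on the set `Z`, and constant elsewhere. -/
noncomputable def localLoop {Z : Set (I^Fin 3)} {p : (I^Fin 3) → Fin 3 → ℝ} (h : IsLocal Z p) :
    Ω^ (Fin 3) (specialUnitaryGroup (Fin (2 + N)) ℂ) 1 :=
  ⟨⟨_, continuous_piecewise_bubbleSU N h.continuous h.frontier⟩, fun x hx => by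
    change (if x ∈ Z then bubbleSU N (p x) else 1) = 1
    split_ifs with hZ
    · exact bubbleSU_of_one_le N (h.boundary x hx hZ)
    · rfl⟩

open scoped Classical in
theorem localLoop_apply {Z : Set (I^Fin 3)} {p : (I^Fin 3) → Fin 3 → ℝ} (h : IsLocal Z p)
    (x : I^Fin 3) : localLoop N h x = if x ∈ Z then bubbleSU N (p x) else 1 := rfl

theorem localLoop_homotopic {Z : Set (I^Fin 3)} {p q : (I^Fin 3) → Fin 3 → ℝ} (hp : IsLocal Z p)
    (hq : IsLocal Z q) (P : I × (I^Fin 3) → Fin 3 → ℝ) (hP : Continuous P)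
    (h₀ : ∀ x, P (0, x) = p x) (h₁ : ∀ x, P (1, x) = q x)
    (hloc : ∀ t, IsLocal Z fun x => P (t, x)) :
    GenLoop.Homotopic (localLoop N hp) (localLoop N hq) := by
  classical
  refine GenLoop.homotopic_of_continuous
    (fun z => if z ∈ Prod.snd ⁻¹' Z then bubbleSU N (P z) else 1)
    (continuous_piecewise_bubbleSU N hP ?_) (fun x => ?_) (fun x => ?_) fun t x hx => ?_
  · rw [← isOpenMap_snd.preimage_frontier_eq_frontier_preimage continuous_snd]
    exact fun z hz => (hloc z.1).frontier z.2 hz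
  · rw [localLoop_apply, h₀]
    rfl
  · rw [localLoop_apply, h₁]
    rfl
  · exact GenLoop.boundary (localLoop N (hloc t)) x hx

theorem IsLocal.smul {Z : Set (I^Fin 3)} {p : (I^Fin 3) → Fin 3 → ℝ} (hp : IsLocal Z p) {s : ℝ}
    (hs : 1 ≤ s) : IsLocal Z fun x => s • p x := by
  have h : ∀ x, 1 ≤ ‖p x‖ → 1 ≤ ‖s • p x‖ := fun x hx => by
    rw [norm_smul, Real.norm_of_nonneg (by linarith)]
    exact one_le_mul_of_one_le_of_one_le hs hx
  exact ⟨hp.continuous.const_smul s, fun x hx => h x (hp.frontier x hx),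
    fun x hx hZ => h x (hp.boundary x hx hZ)⟩

theorem localLoop_homotopic_smul {Z : Set (I^Fin 3)} {p : (I^Fin 3) → Fin 3 → ℝ}
    (hp : IsLocal Z p) {s : ℝ} (hs : 1 ≤ s) :
    GenLoop.Homotopic (localLoop N hp) (localLoop N (hp.smul hs)) := by
  have hpc := hp.continuous
  refine localLoop_homotopic N hp (hp.smul hs) (fun z => (1 + (z.1 : ℝ) * (s - 1)) • p z.2)
    (by fun_prop) (fun x => by simp) (fun x => by simp) fun t =>
      hp.smul (s := 1 + (t : ℝ) * (s - 1)) ?_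
  have := mul_nonneg t.2.1 (sub_nonneg.mpr hs)
  linarith

/-- The condition under which `h` defines a loop through `quatLoop`. -/
structure IsQuatLoop (h : (I^Fin 3) → (Fin 3 → ℝ) × ℝ) : Prop where
  continuous : Continuous h
  ne_zero : ∀ x, h x ≠ 0
  boundary : ∀ x ∈ Cube.boundary (Fin 3), (h x).1 = 0 ∧ 0 < (h x).2

theorem quatSU_eq_one {v : (Fin 3 → ℝ) × ℝ} (h : v.1 = 0 ∧ 0 < v.2) : quatSU N v = 1 := by
  have : v = (0, v.2) := Prod.ext h.1 rfl
  rw [this, quatSU_of_pos N h.2]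

/-- The loop of special unitary matrices defined by a map into the nonzero quaternions. -/
noncomputable def quatLoop {h : (I^Fin 3) → (Fin 3 → ℝ) × ℝ} (hh : IsQuatLoop h) :
    Ω^ (Fin 3) (specialUnitaryGroup (Fin (2 + N)) ℂ) 1 :=
  ⟨⟨_, (continuousOn_quatSU N).comp_continuous hh.continuous hh.ne_zero⟩,
    fun x hx => quatSU_eq_one N (hh.boundary x hx)⟩

theorem quatLoop_apply {h : (I^Fin 3) → (Fin 3 → ℝ) × ℝ} (hh : IsQuatLoop h) (x : I^Fin 3) :
    quatLoop N hh x = quatSU N (h x) := rfl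

theorem quatLoop_homotopic {h k : (I^Fin 3) → (Fin 3 → ℝ) × ℝ} (hh : IsQuatLoop h)
    (hk : IsQuatLoop k) (hl : ∀ x, ∀ t ∈ I, (1 - t) • h x + t • k x ≠ 0) :
    GenLoop.Homotopic (quatLoop N hh) (quatLoop N hk) := by
  have hhc := hh.continuous
  have hkc := hk.continuous
  refine GenLoop.homotopic_of_continuous
    (fun z => quatSU N ((1 - z.1 : ℝ) • h z.2 + (z.1 : ℝ) • k z.2))
    ((continuousOn_quatSU N).comp_continuous (by fun_prop) fun z => hl z.2 z.1 z.1.2)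
    (fun x => by simp [quatLoop_apply]) (fun x => by simp [quatLoop_apply]) fun t x hx => ?_
  refine quatSU_eq_one N ⟨?_, ?_⟩
  · simp [(hh.boundary x hx).1, (hk.boundary x hx).1]
  · have h1 := (hh.boundary x hx).2
    have h2 := (hk.boundary x hx).2
    have := t.2.1
    have := t.2.2
    simp only [Prod.snd_add, Prod.smul_snd, smul_eq_mul]
    rcases (t.2.1).eq_or_lt with h0 | h0
    · rw [← h0]; simpa using h1
    · have := mul_pos h0 h2
      have := mul_nonneg (sub_nonneg.mpr t.2.2) h1.le
      linarith

end Matrix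

end LocalLoops

section LinearLoops

namespace Matrix

open scoped Topology.Homotopy unitInterval

section Joined

variable {n : Type*} [Fintype n] [DecidableEq n]

theorem joinedIn_of_segment {M M' : Matrix n n ℝ}
    (h : ∀ t ∈ I, (M + t • (M' - M)).det ≠ 0) : JoinedIn {A : Matrix n n ℝ | A.det ≠ 0} M M' := by
  refine ⟨⟨⟨fun t : I => M + (t : ℝ) • (M' - M), by fun_prop⟩, by simp, by simp⟩, fun t => h t t.2⟩

/-- Every invertible real matrix can be joined to a diagonal matrix of signs. -/
theorem exists_joinedIn_diagonal {M : Matrix n n ℝ} (hM : M.det ≠ 0) :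
    ∃ ε : n → ℝ, (∀ i, ε i = 1 ∨ ε i = -1) ∧
      JoinedIn {A : Matrix n n ℝ | A.det ≠ 0} M (diagonal ε) := by
  refine diagonal_transvection_induction_of_det_ne_zero (fun M : Matrix n n ℝ => ∃ ε : n → ℝ,
    (∀ i, ε i = 1 ∨ ε i = -1) ∧ JoinedIn {A : Matrix n n ℝ | A.det ≠ 0} M (diagonal ε)) M hM
    ?_ ?_ ?_
  · intro D hD
    rw [det_diagonal, Finset.prod_ne_zero_iff] at hD
    refine ⟨fun i => if 0 < D i then 1 else -1, fun i => by dsimp; split_ifs <;> simp,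
      joinedIn_of_segment fun t ht => ?_⟩
    rw [diagonal_sub, ← diagonal_smul, diagonal_add, det_diagonal, Finset.prod_ne_zero_iff]
    intro i _
    have hDi := hD i (Finset.mem_univ i)
    obtain ⟨h0, h1⟩ := ht
    simp only [Pi.smul_apply, smul_eq_mul]
    split_ifs with h
    · rcases h0.eq_or_lt with rfl | h0
      · simpa using hDi
      · have : 0 ≤ (1 - t) * D i := mul_nonneg (by linarith) h.le
        refine ne_of_gt ?_
        nlinarith
    · have h' : D i < 0 := lt_of_le_of_ne (not_lt.mp h) hDi
      rcases h0.eq_or_lt with rfl | h0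
      · simpa using hDi
      · have : (1 - t) * D i ≤ 0 := mul_nonpos_of_nonneg_of_nonpos (by linarith) h'.le
        refine ne_of_lt ?_
        nlinarith
  · intro t
    refine ⟨1, fun i => Or.inl rfl, ?_⟩
    have h1 : diagonal (1 : n → ℝ) = 1 := diagonal_one
    rw [h1]
    refine joinedIn_of_segment fun s _ => ?_
    have : t.toMatrix + s • (1 - t.toMatrix) = transvection t.i t.j ((1 - s) * t.c) := by
      ext a b
      simp [TransvectionStruct.toMatrix, transvection, single_apply]
      split_ifs <;> ring
    rw [this, det_transvection_of_ne _ _ t.hij]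
    exact one_ne_zero
  · rintro A B - - ⟨ε, hε, γ, hγ⟩ ⟨τ, hτ, γ', hγ'⟩
    refine ⟨ε * τ, fun i => ?_, ?_⟩
    · rcases hε i with h | h <;> rcases hτ i with h' | h' <;> simp [h, h']
    · refine ⟨⟨⟨fun t => γ t * γ' t, by fun_prop⟩, by simp, ?_⟩, fun t => ?_⟩
      · simp [diagonal_mul_diagonal]
      · change (γ t * γ' t).det ≠ 0
        rw [det_mul]
        exact mul_ne_zero (hγ t) (hγ' t)

end Joined

/-- The inclusion of the cube in the vector space. -/
def cubeVal (x : I^Fin 3) : Fin 3 → ℝ := fun i => x i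

theorem continuous_cubeVal : Continuous cubeVal := by
  unfold cubeVal
  fun_prop

theorem isLocal_univ_iff {p : (I^Fin 3) → Fin 3 → ℝ} : IsLocal Set.univ p ↔
    Continuous p ∧ ∀ x ∈ Cube.boundary (Fin 3), 1 ≤ ‖p x‖ :=
  ⟨fun h => ⟨h.1, fun x hx => h.3 x hx trivial⟩, fun h => ⟨h.1, by simp, fun x hx _ => h.2 x hx⟩⟩

theorem isClosed_cubeBoundary : IsClosed (Cube.boundary (Fin 3)) := by
  have : Cube.boundary (Fin 3) = ⋃ i : Fin 3, {x : I^Fin 3 | x i = 0} ∪ {x | x i = 1} := by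
    ext x
    simp [Cube.boundary]
  rw [this]
  refine isClosed_iUnion_of_finite fun i => IsClosed.union ?_ ?_
  · exact isClosed_eq (continuous_apply i) continuous_const
  · exact isClosed_eq (continuous_apply i) continuous_const

variable (N : ℕ)

theorem localLoop_homotopic_of_path {B : I → Matrix (Fin 3) (Fin 3) ℝ} (hB : Continuous B)
    (hB0 : ∀ t, (B t).det ≠ 0) {c : I → Fin 3 → ℝ} (hc : Continuous c)
    (hc0 : ∀ t i, c t i ∈ Set.Ioo (0 : ℝ) 1)
    (h₀ : IsLocal Set.univ fun x => B 0 *ᵥ (cubeVal x - c 0))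
    (h₁ : IsLocal Set.univ fun x => B 1 *ᵥ (cubeVal x - c 1)) :
    GenLoop.Homotopic (localLoop N h₀) (localLoop N h₁) := by
  set P : I × (I^Fin 3) → Fin 3 → ℝ := fun z => B z.1 *ᵥ (cubeVal z.2 - c z.1) with hP
  have hPc : Continuous P := by
    have := continuous_cubeVal
    fun_prop
  have hpos : ∀ z ∈ (Set.univ : Set I) ×ˢ Cube.boundary (Fin 3), 0 < ‖P z‖ := by
    rintro ⟨t, x⟩ ⟨-, i, (hi : x i = 0 ∨ x i = 1)⟩
    refine norm_pos_iff.mpr fun h => ?_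
    have h2 := congrFun (eq_zero_of_mulVec_eq_zero (hB0 t) h) i
    have h3 := hc0 t i
    simp only [cubeVal, Pi.sub_apply, Pi.zero_apply, sub_eq_zero] at h2
    rw [← h2] at h3
    rcases hi with hi | hi <;> simp [hi] at h3
  obtain ⟨μ, hμ, hμP⟩ : ∃ μ > 0, ∀ z ∈ (Set.univ : Set I) ×ˢ Cube.boundary (Fin 3), μ ≤ ‖P z‖ :=
    (isCompact_univ.prod isClosed_cubeBoundary.isCompact).exists_forall_le' hPc.norm.continuousOn
      hpos
  set s := max 1 μ⁻¹
  have hs : 1 ≤ s := le_max_left _ _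
  refine (localLoop_homotopic_smul N h₀ hs).trans (GenLoop.Homotopic.trans ?_
    (localLoop_homotopic_smul N h₁ hs).symm)
  refine localLoop_homotopic N _ _ (fun z => s • P z) (by fun_prop) (fun x => rfl) (fun x => rfl)
    fun t => isLocal_univ_iff.mpr ⟨by fun_prop, fun x hx => ?_⟩
  rw [norm_smul, Real.norm_of_nonneg (by linarith)]
  calc 1 = μ⁻¹ * μ := (inv_mul_cancel₀ hμ.ne').symm
    _ ≤ s * ‖P (t, x)‖ := mul_le_mul (le_max_right _ _) (hμP _ ⟨trivial, hx⟩) hμ.le (by linarith)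

theorem isLocal_sign {ε : Fin 3 → ℝ} (hε : ∀ i, ε i = 1 ∨ ε i = -1) :
    IsLocal Set.univ fun x => ((4 : ℝ) • diagonal ε) *ᵥ (cubeVal x - fun _ => 1 / 2) := by
  have := continuous_cubeVal
  refine isLocal_univ_iff.mpr ⟨by fun_prop, fun x ⟨i, hi⟩ => le_trans ?_ (norm_le_pi_norm _ i)⟩
  rw [smul_mulVec, Pi.smul_apply, mulVec_diagonal]
  rcases hi with hi | hi <;> rcases hε i with h | h <;> simp [cubeVal, hi, h] <;> norm_num

theorem isLocal_generator :
    IsLocal Set.univ fun x => ((4 : ℝ) • diagonal (1 : Fin 3 → ℝ)) *ᵥ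
      (cubeVal x - fun _ => 1 / 2) :=
  isLocal_sign fun _ => Or.inl rfl

/-- The generator of the third homotopy group of a special unitary group. -/
noncomputable def generator : π_ 3 (specialUnitaryGroup (Fin (2 + N)) ℂ) 1 :=
  GenLoop.toClass (localLoop N isLocal_generator)

theorem toClass_localLoop_sign_mem (S : Finset (Fin 3)) :
    ∀ (ε : Fin 3 → ℝ) (hε : ∀ i, ε i = 1 ∨ ε i = -1), (∀ i, ε i = -1 → i ∈ S) →
      GenLoop.toClass (localLoop N (isLocal_sign hε)) ∈ Subgroup.zpowers (generator N) := by
  induction S using Finset.induction_on with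
  | empty =>
    intro ε hε hS
    obtain rfl : ε = 1 := funext fun i => (hε i).resolve_right fun h => by simpa using hS i h
    exact Subgroup.mem_zpowers _
  | insert i S hi ih =>
    intro ε hε hS
    by_cases hεi : ε i = 1
    · refine ih ε hε fun j hj => (Finset.mem_insert.mp (hS j hj)).resolve_left ?_
      rintro rfl
      rw [hεi] at hj
      norm_num at hj
    have hεi' := (hε i).resolve_left hεi
    have hτ : ∀ j, Function.update ε i 1 j = 1 ∨ Function.update ε i 1 j = -1 := fun j => by
      rcases eq_or_ne j i with rfl | hj
      · simp
      · simpa [hj] using hε j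
    have key := ih _ hτ fun j hj => by
      rcases eq_or_ne j i with rfl | hji
      · norm_num at hj
      · rw [Function.update_of_ne hji] at hj
        exact (Finset.mem_insert.mp (hS j hj)).resolve_left hji
    have : localLoop N (isLocal_sign hε) =
        GenLoop.symmAt i (localLoop N (isLocal_sign hτ)) := by
      ext1 x
      simp only [GenLoop.symmAt, GenLoop.coe_copy, localLoop_apply, Set.mem_univ, if_true]
      congr 1
      ext j
      rw [smul_mulVec, smul_mulVec, Pi.smul_apply, Pi.smul_apply, mulVec_diagonal, mulVec_diagonal]
      rcases eq_or_ne j i with rfl | hj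
      · simp [cubeVal, hεi']
        ring
      · simp [cubeVal, hj]
    rw [this, GenLoop.toClass_symmAt]
    exact inv_mem key

theorem toClass_localLoop_linear_mem {B : Matrix (Fin 3) (Fin 3) ℝ} (hB : B.det ≠ 0)
    {c : Fin 3 → ℝ} (hc : ∀ i, c i ∈ Set.Ioo (0 : ℝ) 1)
    (h : IsLocal Set.univ fun x => B *ᵥ (cubeVal x - c)) :
    GenLoop.toClass (localLoop N h) ∈ Subgroup.zpowers (generator N) := by
  have hB' : ((4 : ℝ)⁻¹ • B).det ≠ 0 := by
    rw [det_smul]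
    exact mul_ne_zero (by norm_num) hB
  obtain ⟨ε, hε, γ, hγ⟩ := exists_joinedIn_diagonal hB'
  have key := toClass_localLoop_sign_mem N Finset.univ ε hε fun i _ => Finset.mem_univ i
  set B' : I → Matrix (Fin 3) (Fin 3) ℝ := fun t => (4 : ℝ) • γ t with hB'
  set c' : I → Fin 3 → ℝ := fun t => (1 - t : ℝ) • c + (t : ℝ) • fun _ => 1 / 2 with hc'
  have eB0 : B' 0 = B := by simp [hB']
  have eB1 : B' 1 = (4 : ℝ) • diagonal ε := by simp [hB']
  have ec0 : c' 0 = c := by simp [hc']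
  have ec1 : c' 1 = fun _ => 1 / 2 := by simp [hc']
  have h₀ : IsLocal Set.univ fun x => B' 0 *ᵥ (cubeVal x - c' 0) := by rwa [eB0, ec0]
  have h₁ : IsLocal Set.univ fun x => B' 1 *ᵥ (cubeVal x - c' 1) := by
    rw [eB1, ec1]
    exact isLocal_sign hε
  have e := GenLoop.toClass_eq_iff.mpr (localLoop_homotopic_of_path N (B := B') (by fun_prop)
    (fun t => by
      simp only [hB', det_smul]
      exact mul_ne_zero (by norm_num) (hγ t))
    (c := c') (by fun_prop) (fun t i => by
      have := convex_Ioo (0 : ℝ) 1 (hc i) (show (1 / 2 : ℝ) ∈ Set.Ioo 0 1 by norm_num)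
        (sub_nonneg.mpr t.2.2) t.2.1 (by ring)
      simpa [hc'] using this) h₀ h₁)
  simp only [eB0, eB1, ec0, ec1] at e
  rw [e]
  exact key

end Matrix

end LinearLoops

section LocalDegree

namespace Matrix

open scoped Topology.Homotopy unitInterval

theorem dist_cubeVal (x y : I^Fin 3) : ‖cubeVal x - cubeVal y‖ = dist x y := by
  rw [← dist_eq_norm]
  rfl

/-- The points of the cube at distance at most `δ` of a finite set. -/
def thickening (T : Finset (I^Fin 3)) (δ : ℝ) : Set (I^Fin 3) := {x | ∃ i ∈ T, dist x i ≤ δ}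

theorem isLocal_thickening {T : Finset (I^Fin 3)} {δ : ℝ}
    (hT : ∀ i ∈ T, ∀ x ∈ Cube.boundary (Fin 3), δ < dist x i) {p : (I^Fin 3) → Fin 3 → ℝ}
    (hp : Continuous p) (h : ∀ i ∈ T, ∀ x, dist x i = δ → 1 ≤ ‖p x‖) :
    IsLocal (thickening T δ) p := by
  refine ⟨hp, fun x hx => ?_, fun x hx ⟨i, hi, hxi⟩ => absurd hxi (hT i hi x hx).not_ge⟩
  have hclosed : IsClosed (thickening T δ) := by
    have : thickening T δ = ⋃ i ∈ T, Metric.closedBall i δ := by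
      ext y
      simp [thickening]
    rw [this]
    exact T.finite_toSet.isClosed_biUnion fun i _ => Metric.isClosed_closedBall
  rw [hclosed.frontier_eq] at hx
  obtain ⟨⟨i, hi, hxi⟩, hx2⟩ := hx
  refine h i hi x (hxi.eq_of_not_lt fun hlt => hx2 ?_)
  exact mem_interior.mpr ⟨Metric.ball i δ, fun y hy => ⟨i, hi, (Metric.mem_ball.mp hy).le⟩,
    Metric.isOpen_ball, hlt⟩

variable (N : ℕ)

theorem toClass_localLoop_closedBall_mem {p : (I^Fin 3) → Fin 3 → ℝ} {i : I^Fin 3} {δ C s : ℝ}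
    {A : Matrix (Fin 3) (Fin 3) ℝ} (hA : A.det ≠ 0) (hC : 0 < C)
    (hAC : ∀ y, ‖y‖ ≤ C * ‖A *ᵥ y‖) (hδ : 0 < δ) (hs : 2 * C / δ ≤ s)
    (hi : ∀ x ∈ Cube.boundary (Fin 3), δ < dist x i)
    (hp : ∀ x, dist x i ≤ δ → C * ‖p x - A *ᵥ (cubeVal x - cubeVal i)‖ ≤ dist x i / 2)
    (h : IsLocal (thickening {i} δ) fun x => s • p x) :
    GenLoop.toClass (localLoop N h) ∈ Subgroup.zpowers (generator N) := by
  classical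
  have hv := continuous_cubeVal
  have hs0 : 0 < s := lt_of_lt_of_le (by positivity) hs
  have hpc : Continuous p := by
    have : p = fun x => s⁻¹ • s • p x := by
      ext1 x
      rw [smul_smul, inv_mul_cancel₀ hs0.ne', one_smul]
    rw [this]
    exact h.continuous.const_smul s⁻¹
  have hT : ∀ j ∈ ({i} : Finset (I^Fin 3)), ∀ x ∈ Cube.boundary (Fin 3), δ < dist x j := by
    simpa using hi
  set L : (I^Fin 3) → Fin 3 → ℝ := fun x => A *ᵥ (cubeVal x - cubeVal i) with hL
  have hLc : Continuous L := by fun_prop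
  have hLn : ∀ x, dist x i ≤ C * ‖L x‖ := fun x => by
    rw [← dist_cubeVal]
    exact hAC _
  have hline : ∀ t ∈ I, ∀ x, dist x i = δ → 1 ≤ ‖s • (p x + t • (L x - p x))‖ := by
    intro t ht x hx
    have h1 := hp x hx.le
    have h2 := hLn x
    have h3 : ‖L x‖ ≤ ‖p x + t • (L x - p x)‖ + ‖p x - L x‖ := by
      have : L x = (p x + t • (L x - p x)) - (1 - t) • (p x - L x) := by module
      calc ‖L x‖ = ‖(p x + t • (L x - p x)) - (1 - t) • (p x - L x)‖ := congrArg _ this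
        _ ≤ ‖p x + t • (L x - p x)‖ + ‖(1 - t) • (p x - L x)‖ := norm_sub_le _ _
        _ ≤ _ := by
          rw [norm_smul, Real.norm_of_nonneg (by linarith [ht.2])]
          exact add_le_add le_rfl (mul_le_of_le_one_left (norm_nonneg _) (by linarith [ht.1]))
    have h4 := mul_le_mul_of_nonneg_left h3 hC.le
    rw [norm_smul, Real.norm_of_nonneg hs0.le]
    have h5 : δ / (2 * C) ≤ ‖p x + t • (L x - p x)‖ := by
      rw [div_le_iff₀ (by positivity)]
      linarith
    calc 1 = 2 * C / δ * (δ / (2 * C)) := by field_simp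
      _ ≤ s * ‖p x + t • (L x - p x)‖ := mul_le_mul hs h5 (by positivity) hs0.le
  have hloc : ∀ t ∈ I, IsLocal (thickening {i} δ) fun x => s • (p x + t • (L x - p x)) := by
    intro t ht
    refine isLocal_thickening hT (by fun_prop) fun j hj x hx => ?_
    rw [Finset.mem_singleton] at hj
    rw [hj] at hx
    exact hline t ht x hx
  have h₁ : IsLocal (thickening {i} δ) fun x => s • L x := by
    simpa using hloc 1 ⟨zero_le_one, le_rfl⟩
  rw [GenLoop.toClass_eq_iff.mpr (localLoop_homotopic N h h₁
    (fun z => s • (p z.2 + (z.1 : ℝ) • (L z.2 - p z.2))) (by fun_prop) (fun x => by simp)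
    (fun x => by simp) fun t => hloc t t.2)]
  have hfar : ∀ x, δ ≤ dist x i → 1 ≤ ‖s • L x‖ := fun x hx => by
    have h2 := hLn x
    rw [norm_smul, Real.norm_of_nonneg hs0.le]
    have h5 : δ / (2 * C) ≤ ‖L x‖ := by
      rw [div_le_iff₀ (by positivity)]
      linarith
    calc 1 = 2 * C / δ * (δ / (2 * C)) := by field_simp
      _ ≤ s * ‖L x‖ := mul_le_mul hs h5 (by positivity) hs0.le
  have h₂ : IsLocal Set.univ fun x => (s • A) *ᵥ (cubeVal x - cubeVal i) := by
    refine isLocal_univ_iff.mpr ⟨by fun_prop, fun x hx => ?_⟩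
    rw [smul_mulVec]
    exact hfar x (hi x hx).le
  have e : localLoop N h₁ = localLoop N h₂ := by
    ext1 x
    rw [localLoop_apply, localLoop_apply, if_pos (Set.mem_univ x), smul_mulVec]
    split_ifs with hx
    · rfl
    · refine (bubbleSU_of_one_le N (hfar x ?_)).symm
      by_contra! hlt
      exact hx ⟨i, Finset.mem_singleton_self i, hlt.le⟩
  rw [e]
  refine toClass_localLoop_linear_mem N ?_ (fun k => ?_) h₂
  · rw [det_smul]
    exact mul_ne_zero (pow_ne_zero _ hs0.ne') hA
  · have hik : i ∉ Cube.boundary (Fin 3) := fun hb => by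
      have := hi i hb
      rw [dist_self] at this
      linarith
    constructor
    · refine lt_of_le_of_ne (i k).2.1 fun h0 => hik ⟨k, Or.inl (Subtype.ext h0.symm)⟩
    · refine lt_of_le_of_ne (i k).2.2 fun h0 => hik ⟨k, Or.inr (Subtype.ext h0)⟩

theorem toClass_localLoop_thickening_mem {p : (I^Fin 3) → Fin 3 → ℝ} (hp : Continuous p) {δ : ℝ}
    (T : Finset (I^Fin 3)) (hsep : ∀ i ∈ T, ∀ j ∈ T, i ≠ j → 2 * δ < dist i j)
    (hmem : ∀ i ∈ T, ∃ h : IsLocal (thickening {i} δ) p,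
      GenLoop.toClass (localLoop N h) ∈ Subgroup.zpowers (generator N)) :
    ∃ h : IsLocal (thickening T δ) p,
      GenLoop.toClass (localLoop N h) ∈ Subgroup.zpowers (generator N) := by
  classical
  induction T using Finset.induction_on with
  | empty =>
    have h0 : thickening ∅ δ = ∅ := by simp [thickening]
    have h : IsLocal (thickening ∅ δ) p := ⟨hp, by simp [h0], by simp [h0]⟩
    refine ⟨h, ?_⟩
    have : localLoop N h = GenLoop.const := by
      ext1 x
      rw [localLoop_apply, if_neg (by simp [h0])]
      rfl
    rw [this]
    exact one_mem _
  | insert i T hi ih =>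
    obtain ⟨h₁, h₁m⟩ := hmem i (Finset.mem_insert_self i T)
    obtain ⟨h₂, h₂m⟩ := ih
      (fun j hj k hk => hsep j (Finset.mem_insert_of_mem hj) k (Finset.mem_insert_of_mem hk))
      (fun j hj => hmem j (Finset.mem_insert_of_mem hj))
    have hu : thickening (insert i T) δ = thickening {i} δ ∪ thickening T δ := by
      ext x
      simp [thickening]
    have h : IsLocal (thickening (insert i T) δ) p := by
      refine ⟨hp, fun x hx => ?_, fun x hx hxZ => ?_⟩
      · rw [hu] at hx
        rcases frontier_union_subset _ _ hx with hx | hx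
        · exact h₁.frontier x hx.1
        · exact h₂.frontier x hx.2
      · rw [hu] at hxZ
        rcases hxZ with hxZ | hxZ
        · exact h₁.boundary x hx hxZ
        · exact h₂.boundary x hx hxZ
    refine ⟨h, ?_⟩
    have e : localLoop N h = GenLoop.pmul (localLoop N h₁) (localLoop N h₂) := by
      ext1 x
      rw [GenLoop.pmul_apply, localLoop_apply, localLoop_apply, localLoop_apply, hu]
      by_cases hx₁ : x ∈ thickening {i} δ
      · have hx₂ : x ∉ thickening T δ := by
          rintro ⟨j, hj, hxj⟩
          obtain ⟨k, hk, hxi⟩ := hx₁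
          obtain rfl := Finset.mem_singleton.mp hk
          have := hsep k (Finset.mem_insert_self k T) j (Finset.mem_insert_of_mem hj)
            fun h => hi (h ▸ hj)
          have := dist_triangle_left k j x
          linarith
        simp [hx₁, hx₂]
      · simp [hx₁]
    rw [e, GenLoop.toClass_pmul]
    exact mul_mem h₂m h₁m

theorem toClass_localLoop_mem {Z : Set (I^Fin 3)} (hZ : IsClosed Z)
    {p : (Fin 3 → ℝ) → Fin 3 → ℝ} (hp : ContDiff ℝ 1 p) (h : IsLocal Z fun x => p (cubeVal x))
    (hreg : ∀ x, p x = 0 → (LinearMap.toMatrix' (fderiv ℝ p x).toLinearMap).det ≠ 0) :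
    GenLoop.toClass (localLoop N h) ∈ Subgroup.zpowers (generator N) := by
  classical
  have hv := continuous_cubeVal
  have hpc := hp.continuous
  set A : (I^Fin 3) → Matrix (Fin 3) (Fin 3) ℝ := fun i =>
    LinearMap.toMatrix' (fderiv ℝ p (cubeVal i)).toLinearMap with hA
  have hAv : ∀ i y, A i *ᵥ y = fderiv ℝ p (cubeVal i) y := fun i y =>
    LinearMap.toMatrix'_mulVec _ _
  set S : Set (I^Fin 3) := {x | x ∈ Z ∧ p (cubeVal x) = 0} with hS
  have hdet : ∀ i ∈ S, (A i).det ≠ 0 := fun i hi => hreg _ hi.2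
  have hC : ∀ i ∈ S, ∃ C > 0, ∀ y, ‖y‖ ≤ C * ‖A i *ᵥ y‖ := by
    intro i hi
    have hinj : Function.Injective (fderiv ℝ p (cubeVal i)) := by
      rw [injective_iff_map_eq_zero]
      intro y hy
      rw [← hAv] at hy
      exact eq_zero_of_mulVec_eq_zero (hdet i hi) hy
    obtain ⟨K, hK, hKl⟩ := (fderiv ℝ p (cubeVal i)).toLinearMap.exists_antilipschitzWith
      (LinearMap.ker_eq_bot.mpr hinj)
    refine ⟨K, by exact_mod_cast hK, fun y => ?_⟩
    have := hKl.le_mul_dist y 0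
    simpa [hAv] using this
  choose! C hC0 hCA using hC
  have hδ : ∀ i ∈ S, ∃ δ > 0, ∀ x, dist x i < δ → x ∈ Z ∧ x ∉ Cube.boundary (Fin 3) ∧
      C i * ‖p (cubeVal x) - A i *ᵥ (cubeVal x - cubeVal i)‖ ≤ dist x i / 2 := by
    intro i hi
    have h1 : ∀ᶠ x in 𝓝 i, x ∈ Z := by
      refine mem_interior_iff_mem_nhds.mp ?_
      by_contra hn
      have := h.frontier i (hZ.frontier_eq ▸ ⟨hi.1, hn⟩)
      rw [hi.2, norm_zero] at this
      norm_num at this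
    have h2 : ∀ᶠ x in 𝓝 i, x ∉ Cube.boundary (Fin 3) := by
      refine isClosed_cubeBoundary.isOpen_compl.mem_nhds fun hb => ?_
      have := h.boundary i hb hi.1
      rw [hi.2, norm_zero] at this
      norm_num at this
    have h3 : ∀ᶠ x in 𝓝 i,
        C i * ‖p (cubeVal x) - A i *ᵥ (cubeVal x - cubeVal i)‖ ≤ dist x i / 2 := by
      have hd := (hp.differentiable one_ne_zero (cubeVal i)).hasFDerivAt
      have := hd.isLittleO.def (c := 1 / (2 * C i)) (by have := hC0 i hi; positivity)
      filter_upwards [hv.continuousAt.eventually this] with x hx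
      rw [hi.2, sub_zero, ← hAv, dist_cubeVal] at hx
      have hCi := hC0 i hi
      calc _ ≤ C i * (1 / (2 * C i) * dist x i) := mul_le_mul_of_nonneg_left hx hCi.le
        _ = _ := by field_simp
    exact Metric.eventually_nhds_iff.mp (h1.and (h2.and h3))
  choose! δ hδ0 hδx using hδ
  have hSc : IsCompact S := (hZ.inter (isClosed_eq (by fun_prop) continuous_const)).isCompact
  have hsep : ∀ i ∈ S, ∀ j ∈ S, i ≠ j → δ i ≤ dist j i := by
    intro i hi j hj hij
    by_contra! hlt
    have h1 := (hδx i hi j hlt).2.2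
    have h2 := hCA i hi (cubeVal j - cubeVal i)
    rw [hj.2, zero_sub, norm_neg] at h1
    rw [dist_cubeVal] at h2
    have := dist_pos.mpr hij.symm
    linarith
  have hfin : S.Finite := by
    obtain ⟨t, htS⟩ := hSc.elim_nhds_subcover' (fun i _ => Metric.ball i (δ i))
      fun i hi => Metric.ball_mem_nhds i (hδ0 i hi)
    refine (t.finite_toSet.image Subtype.val).subset fun j hj => ?_
    obtain ⟨i, hit, hji⟩ := Set.mem_iUnion₂.mp (htS hj)
    refine ⟨i, hit, ?_⟩
    by_contra hij
    exact absurd (Metric.mem_ball.mp hji) (hsep i i.2 j hj hij).not_gt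
  obtain ⟨d, hd0, hd⟩ : ∃ d > 0, ∀ i ∈ S, 3 * d < δ i := by
    have h1 : ∀ᶠ d : ℝ in 𝓝[>] 0, ∀ i ∈ S, 3 * d < δ i := by
      refine (Filter.eventually_all_finite hfin).mpr fun i hi => ?_
      have : ∀ᶠ d : ℝ in 𝓝 0, 3 * d < δ i :=
        (by fun_prop : Continuous fun d : ℝ => 3 * d).continuousAt.eventually_lt
          continuousAt_const (by simpa using hδ0 i hi)
      exact this.filter_mono nhdsWithin_le_nhds
    obtain ⟨d, hd, hd0⟩ := (h1.and self_mem_nhdsWithin).exists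
    exact ⟨d, hd0, hd⟩
  have hfar : IsCompact {x | x ∈ Z ∧ ∀ i ∈ S, d ≤ dist x i} := by
    have h1 : {x : I^Fin 3 | ∀ i ∈ S, d ≤ dist x i} = ⋂ i ∈ S, {x | d ≤ dist x i} := by
      ext
      simp
    have h2 : IsClosed {x : I^Fin 3 | ∀ i ∈ S, d ≤ dist x i} := by
      rw [h1]
      exact isClosed_biInter fun i _ => isClosed_le continuous_const (by fun_prop)
    exact (hZ.inter h2).isCompact
  obtain ⟨μ, hμ0, hμ⟩ := hfar.exists_forall_le' (f := fun x => ‖p (cubeVal x)‖) (a := 0)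
    (by fun_prop) fun x hx => norm_pos_iff.mpr fun h0 => by
      have := hx.2 x ⟨hx.1, h0⟩
      rw [dist_self] at this
      linarith
  obtain ⟨s, hs1, hsμ, hsC⟩ : ∃ s : ℝ, 1 ≤ s ∧ μ⁻¹ ≤ s ∧ ∀ i ∈ S, 2 * C i / d ≤ s := by
    have h1 : ∀ᶠ s : ℝ in Filter.atTop, ∀ i ∈ S, 2 * C i / d ≤ s :=
      (Filter.eventually_all_finite hfin).mpr fun i _ => Filter.eventually_ge_atTop _
    exact ((Filter.eventually_ge_atTop 1).and ((Filter.eventually_ge_atTop _).and h1)).exists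
  have hs0 : 0 < s := by linarith
  rw [GenLoop.toClass_eq_iff.mpr (localLoop_homotopic_smul N h hs1)]
  have hbd : ∀ i ∈ S, ∀ x ∈ Cube.boundary (Fin 3), d < dist x i := by
    intro i hi x hx
    by_contra! hle
    exact (hδx i hi x (by linarith [hd i hi])).2.1 hx
  have hball : ∀ i ∈ S, ∀ x, dist x i ≤ d → dist x i < δ i := fun i hi x hx => by
    linarith [hd i hi]
  have hlarge : ∀ x ∈ Z, (∀ i ∈ S, d ≤ dist x i) → 1 ≤ ‖s • p (cubeVal x)‖ := by
    intro x hx hxd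
    rw [norm_smul, Real.norm_of_nonneg hs0.le]
    calc 1 = μ⁻¹ * μ := (inv_mul_cancel₀ hμ0.ne').symm
      _ ≤ s * ‖p (cubeVal x)‖ := mul_le_mul hsμ (hμ x ⟨hx, hxd⟩) hμ0.le hs0.le
  have hfarS : ∀ i ∈ S, ∀ x, dist x i = d → ∀ j ∈ S, d ≤ dist x j := by
    intro i hi x hx j hj
    rcases eq_or_ne i j with rfl | hij
    · exact hx.ge
    · have := hsep i hi j hj hij
      have := hd i hi
      have := dist_triangle_left j i x
      linarith
  obtain ⟨h', h'm⟩ := toClass_localLoop_thickening_mem N (p := fun x => s • p (cubeVal x))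
    (by fun_prop) (δ := d) hfin.toFinset (fun i hi j hj hij => by
      rw [hfin.mem_toFinset] at hi hj
      have := hsep i hi j hj hij
      have := hd i hi
      rw [dist_comm]
      linarith) (fun i hi => by
      rw [hfin.mem_toFinset] at hi
      have hl : IsLocal (thickening {i} d) fun x => s • p (cubeVal x) := by
        refine isLocal_thickening (by simpa using hbd i hi) (by fun_prop) fun j hj x hx => ?_
        obtain rfl := Finset.mem_singleton.mp hj
        exact hlarge x (hδx j hi x (hball j hi x hx.le)).1 (hfarS j hi x hx)
      exact ⟨hl, toClass_localLoop_closedBall_mem N (hdet i hi) (hC0 i hi) (hCA i hi) hd0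
        (hsC i hi) (hbd i hi) (fun x hx => (hδx i hi x (hball i hi x hx)).2.2) hl⟩)
  have e : localLoop N (h.smul hs1) = localLoop N h' := by
    ext1 x
    rw [localLoop_apply, localLoop_apply]
    by_cases hx : x ∈ thickening hfin.toFinset d
    · rw [if_pos hx]
      obtain ⟨i, hi, hxi⟩ := hx
      rw [hfin.mem_toFinset] at hi
      rw [if_pos (hδx i hi x (hball i hi x hxi)).1]
    · rw [if_neg hx]
      split_ifs with hxZ
      · refine bubbleSU_of_one_le N (hlarge x hxZ fun i hi => ?_)
        by_contra! hlt
        exact hx ⟨i, hfin.mem_toFinset.mpr hi, hlt.le⟩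
      · rfl
  rw [e]
  exact h'm

end Matrix

end LocalDegree

section Cyclicity

namespace Matrix

open scoped Topology.Homotopy unitInterval
open MeasureTheory

/-- A continuous map can be approximated by a differentiable one for which zero is a regular
value. -/
theorem exists_contDiff_approx_regular {f : (Fin 3 → ℝ) → Fin 3 → ℝ} (hf : Continuous f) {ε : ℝ}
    (hε : 0 < ε) : ∃ p : (Fin 3 → ℝ) → Fin 3 → ℝ, ContDiff ℝ 1 p ∧ (∀ x, ‖p x - f x‖ < ε) ∧
      ∀ x, p x = 0 → (LinearMap.toMatrix' (fderiv ℝ p x).toLinearMap).det ≠ 0 := by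
  obtain ⟨g, hg, hgf, -⟩ := hf.exists_contDiff_approx 1 (ε := fun _ => ε / 2) continuous_const
    fun _ => by positivity
  set s := {x | (fderiv ℝ g x).det = 0}
  have hnull : volume (g '' s) = 0 :=
    addHaar_image_eq_zero_of_det_fderivWithin_eq_zero volume (f' := fderiv ℝ g)
      (fun x _ => ((hg.differentiable one_ne_zero) x).hasFDerivAt.hasFDerivWithinAt) fun x hx => hx
  obtain ⟨v, hv, hvε⟩ := (Measure.dense_of_ae (compl_mem_ae_iff.mpr hnull)).exists_dist_lt
    0 (half_pos hε)
  refine ⟨fun x => g x - v, hg.sub contDiff_const, fun x => ?_, fun x hx => ?_⟩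
  · have h1 := hgf x
    rw [dist_eq_norm] at h1
    rw [dist_eq_norm, zero_sub, norm_neg] at hvε
    calc ‖g x - v - f x‖ = ‖(g x - f x) - v‖ := by congr 1; abel
      _ ≤ ‖g x - f x‖ + ‖v‖ := norm_sub_le _ _
      _ < ε := by linarith
  · rw [fderiv_sub_const, LinearMap.det_toMatrix']
    exact fun h0 => hv ⟨x, h0, sub_eq_zero.mp hx⟩

/-- The coordinatewise retraction of the vector space onto the cube. -/
noncomputable def cubeClamp (y : Fin 3 → ℝ) : I^Fin 3 := fun i => Set.projIcc 0 1 zero_le_one (y i)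

theorem continuous_cubeClamp : Continuous cubeClamp := by
  unfold cubeClamp
  fun_prop

theorem cubeClamp_cubeVal (x : I^Fin 3) : cubeClamp (cubeVal x) = x :=
  funext fun i => Set.projIcc_val zero_le_one (x i)

theorem half_le_norm_fst {v : (Fin 3 → ℝ) × ℝ} (h : sqNorm v = 1) (h0 : v.2 = 0) :
    1 / 2 ≤ ‖v.1‖ := by
  by_contra! hlt
  have h1 : ∀ i, v.1 i ^ 2 < 1 / 4 := fun i => by
    have h2 := (norm_le_pi_norm v.1 i).trans_lt hlt
    rw [Real.norm_eq_abs, abs_lt] at h2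
    nlinarith
  have := h1 0
  have := h1 1
  have := h1 2
  rw [sqNorm, h0] at h
  linarith

variable (N : ℕ)

theorem toClass_quatLoop_mem {h : (I^Fin 3) → (Fin 3 → ℝ) × ℝ} (hh : IsQuatLoop h)
    (hn : ∀ x, sqNorm (h x) = 1) :
    GenLoop.toClass (quatLoop N hh) ∈ Subgroup.zpowers (generator N) := by
  classical
  have hc := hh.continuous
  have hv := continuous_cubeVal
  have hcl := continuous_cubeClamp
  obtain ⟨p, hp, hpf, hreg⟩ := exists_contDiff_approx_regular
    (f := fun y => (4 : ℝ) • (h (cubeClamp y)).1) (by fun_prop) one_pos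
  have hpc := hp.continuous
  set q : (I^Fin 3) → Fin 3 → ℝ := fun x => p (cubeVal x) with hq
  have hqc : Continuous q := by fun_prop
  have hqh : ∀ x, ‖(4 : ℝ)⁻¹ • q x - (h x).1‖ < 1 / 4 := fun x => by
    have h1 := hpf (cubeVal x)
    simp only [cubeClamp_cubeVal] at h1
    have h2 : (4 : ℝ)⁻¹ • q x - (h x).1 = (4 : ℝ)⁻¹ • (p (cubeVal x) - (4 : ℝ) • (h x).1) := by
      rw [smul_sub, smul_smul]
      norm_num [hq]
    rw [h2, norm_smul]
    norm_num
    linarith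
  have hle : ∀ x, (h x).2 ≤ 1 := fun x => by
    have := hn x
    rw [sqNorm] at this
    nlinarith [sq_nonneg ((h x).1 0), sq_nonneg ((h x).1 1), sq_nonneg ((h x).1 2)]
  have hbd : ∀ x ∈ Cube.boundary (Fin 3), (h x).2 = 1 := fun x hx => by
    have h1 := hn x
    have h2 := (hh.boundary x hx).2
    rw [sqNorm, (hh.boundary x hx).1] at h1
    simp only [Pi.zero_apply] at h1
    nlinarith
  set μ : (I^Fin 3) → ℝ := fun x => min 1 (1 - (h x).2) with hμ
  have hμ0 : ∀ x, 0 ≤ μ x := fun x => le_min zero_le_one (by linarith [hle x])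
  have hμ1 : ∀ x, μ x ≤ 1 := fun x => min_le_left _ _
  have hsmall : ∀ x, (h x).2 = 0 → ∀ s ∈ I, (h x).1 + s • ((4 : ℝ)⁻¹ • q x - (h x).1) ≠ 0 := by
    intro x hx s hs h0
    have h1 := half_le_norm_fst (hn x) hx
    have h2 : (h x).1 = -(s • ((4 : ℝ)⁻¹ • q x - (h x).1)) := eq_neg_of_add_eq_zero_left h0
    have h3 : ‖(h x).1‖ = s * ‖(4 : ℝ)⁻¹ • q x - (h x).1‖ := by
      conv_lhs => rw [h2]
      rw [norm_neg, norm_smul, Real.norm_of_nonneg hs.1]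
    have := hqh x
    have := mul_le_of_le_one_left (norm_nonneg ((4 : ℝ)⁻¹ • q x - (h x).1)) hs.2
    linarith
  set h₁ : (I^Fin 3) → (Fin 3 → ℝ) × ℝ :=
    fun x => ((h x).1 + μ x • ((4 : ℝ)⁻¹ • q x - (h x).1), (h x).2) with hh₁
  have hloop₁ : IsQuatLoop h₁ := by
    refine ⟨by fun_prop, fun x h0 => ?_, fun x hx => ⟨?_, (hh.boundary x hx).2⟩⟩
    · exact hsmall x (congrArg Prod.snd h0) (μ x) ⟨hμ0 x, hμ1 x⟩ (congrArg Prod.fst h0)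
    · simp [hh₁, hμ, hbd x hx, (hh.boundary x hx).1]
  have hom₁ : GenLoop.Homotopic (quatLoop N hh) (quatLoop N hloop₁) := by
    refine quatLoop_homotopic N hh hloop₁ fun x t ht h0 => ?_
    refine hsmall x ?_ (t * μ x) (unitInterval.mul_mem ht ⟨hμ0 x, hμ1 x⟩) ?_
    · have := congrArg Prod.snd h0
      simp only [hh₁, Prod.snd_add, Prod.smul_snd, smul_eq_mul, Prod.snd_zero] at this
      linarith
    · have := congrArg Prod.fst h0
      simp only [hh₁, Prod.fst_add, Prod.smul_fst, Prod.fst_zero] at this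
      rw [← this]
      module
  set Z : Set (I^Fin 3) := {x | (h x).2 ≤ 0} with hZ
  have hZc : IsClosed Z := isClosed_le (by fun_prop) continuous_const
  have hloc : IsLocal Z q := by
    refine ⟨hqc, fun x hx => ?_, fun x hx hxZ => ?_⟩
    · have h1 : (h x).2 = 0 := 
        frontier_le_subset_eq (f := fun x => (h x).2) (g := fun _ => 0) (by fun_prop)
          continuous_const hx
      have h2 := half_le_norm_fst (hn x) h1
      have h3 : ‖(h x).1‖ ≤ ‖(4 : ℝ)⁻¹ • q x‖ + ‖(4 : ℝ)⁻¹ • q x - (h x).1‖ := by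
        have := norm_sub_le ((4 : ℝ)⁻¹ • q x) ((4 : ℝ)⁻¹ • q x - (h x).1)
        rwa [sub_sub_cancel] at this
      have h4 := hqh x
      rw [norm_smul] at h3
      norm_num at h3
      linarith
    · have h1 : (h x).2 ≤ 0 := hxZ
      rw [hbd x hx] at h1
      norm_num at h1
  set k : (I^Fin 3) → (Fin 3 → ℝ) × ℝ := fun x => if x ∈ Z then bubble (q x) else (0, 1) with hk
  have hnotZ : ∀ x ∈ Cube.boundary (Fin 3), x ∉ Z := fun x hx hxZ =>
    (hh.boundary x hx).2.not_ge hxZ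
  have hloopk : IsQuatLoop k := by
    refine ⟨?_, fun x => ?_, fun x hx => ?_⟩
    · exact Continuous.if (fun x hx => bubble_of_one_le (hloc.frontier x hx))
        (continuous_bubble.comp hqc) continuous_const
    · simp only [hk]
      split_ifs with hx
      · exact bubble_ne_zero _
      · simp
    · simp [hk, hnotZ x hx]
  have homk : GenLoop.Homotopic (quatLoop N hloop₁) (quatLoop N hloopk) := by
    refine quatLoop_homotopic N hloop₁ hloopk fun x t ht h0 => ?_
    have hfst := congrArg Prod.fst h0
    have hsnd := congrArg Prod.snd h0
    simp only [Prod.fst_add, Prod.smul_fst, Prod.fst_zero, Prod.snd_add, Prod.smul_snd,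
      smul_eq_mul, Prod.snd_zero] at hfst hsnd
    by_cases hx : x ∈ Z
    · have hx0 : (h x).2 ≤ 0 := hx
      have hμx : μ x = 1 := min_eq_left (by linarith)
      have hkx : k x = bubble (q x) := if_pos hx
      have h1x : (h₁ x).1 = (4 : ℝ)⁻¹ • q x := by simp [hh₁, hμx]
      set b := min 1 (2 * max 0 (1 - ‖q x‖)) with hb
      have hb0 : 0 ≤ b := le_min zero_le_one (by positivity)
      have hbx : (bubble (q x)).1 = b • q x := rfl
      rw [hkx, h1x, hbx, smul_smul, smul_smul, ← add_smul] at hfst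
      have ht1 := sub_nonneg.mpr ht.2
      rcases smul_eq_zero.mp hfst with hco | hq0
      · have h3 := mul_nonneg ht.1 hb0
        have h4 : t = 1 := by linarith
        rw [h4] at h0
        refine bubble_ne_zero (q x) ?_
        simpa [hkx] using h0
      · have h3 := hqh x
        rw [hq0, smul_zero, zero_sub, norm_neg] at h3
        have h4 : (h x).2 < 0 := lt_of_le_of_ne hx0 fun h5 => by
          have := half_le_norm_fst (hn x) h5
          linarith
        have h5 : (k x).2 = -1 := by
          rw [hkx, hq0, bubble_of_le_half (by simp)]
          simp
        have h6 : (1 - t) * (h x).2 + t * -1 = 0 := by rwa [h5] at hsnd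
        rcases ht1.eq_or_lt with h7 | h7
        · nlinarith
        · have := mul_neg_of_pos_of_neg h7 h4
          linarith [ht.1]
    · have hx0 : 0 < (h x).2 := not_le.mp hx
      have h5 : (k x).2 = 1 := by simp [hk, hx]
      have h6 : (1 - t) * (h x).2 + t * 1 = 0 := by rwa [h5] at hsnd
      have h7 := mul_nonneg (sub_nonneg.mpr ht.2) hx0.le
      have h8 : t = 0 := by linarith [ht.1]
      rw [h8] at h6
      linarith
  have e : quatLoop N hloopk = localLoop N hloc := by
    ext1 x
    rw [quatLoop_apply, localLoop_apply]
    simp only [hk]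
    split_ifs with hx
    · rfl
    · exact quatSU_of_pos N one_pos
  rw [GenLoop.toClass_eq_iff.mpr (hom₁.trans homk), e]
  exact toClass_localLoop_mem N hZc hp hloc hreg

theorem mem_zpowers_generator (a : π_ 3 (specialUnitaryGroup (Fin (2 + N)) ℂ) 1) :
    a ∈ Subgroup.zpowers (generator N) := by
  induction a using Quotient.inductionOn with | _ f
  obtain ⟨g, hfg, hg⟩ := exists_homotopicRel_fixesFrom_two (W := Fin 3 → ℝ) (by simp)
    continuous_cubeVal continuous_cubeClamp cubeClamp_cubeVal (B := Cube.boundary (Fin 3)) f.1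
    fun x hx => by
      have : f.1 x = 1 := f.2 x hx
      rw [this]
      intro j _
      exact one_mulVec _
  have hgb : ∀ x ∈ Cube.boundary (Fin 3), g x = 1 := fun x hx => by
    obtain ⟨F⟩ := hfg
    rw [← F.apply_one, F.eq_fst 1 hx]
    exact f.2 x hx
  have hne : ∀ x, quatCoord (g x) ≠ 0 := fun x h0 => by
    have := sqNorm_quatCoord (hg x)
    rw [h0] at this
    simp [sqNorm] at this
  have hloop : IsQuatLoop fun x => quatCoord (g x) := by
    refine ⟨continuous_quatCoord.comp g.continuous, hne, fun x hx => ?_⟩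
    have h1 : quatCoord (1 : specialUnitaryGroup (Fin (2 + N)) ℂ) = (0, 1) := by
      rw [← quatSU_of_pos N one_pos, quatCoord_quatSU (by simp)]
      simp [sqNorm]
    simp [hgb x hx, h1]
  have e : GenLoop.Homotopic f (quatLoop N hloop) := by
    have h2 : (quatLoop N hloop).1 = g := by
      ext1 x
      exact quatSU_quatCoord (hg x)
    change f.1.HomotopicRel (quatLoop N hloop).1 _
    rwa [h2]
  change GenLoop.toClass f ∈ _
  rw [GenLoop.toClass_eq_iff.mpr e]
  exact toClass_quatLoop_mem N hloop fun x => sqNorm_quatCoord (hg x)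

end Matrix

end Cyclicity

section CofactorField

namespace Matrix

theorem hasFDerivAt_det_fin_three {E : Type*} [NormedAddCommGroup E] [NormedSpace ℝ E]
    {B : E → Matrix (Fin 3) (Fin 3) ℝ} {B' : Fin 3 → Fin 3 → E →L[ℝ] ℝ} {w : E}
    (h : ∀ i j, HasFDerivAt (fun w => B w i j) (B' i j) w) :
    ∃ D : E →L[ℝ] ℝ, HasFDerivAt (fun w => (B w).det) D w ∧
      ∀ v, D v = ∑ i, ((B w).updateRow i fun j => B' i j v).det := by
  have hD := (((((((h 0 0).mul (h 1 1)).mul (h 2 2)).sub (((h 0 0).mul (h 1 2)).mul (h 2 1))).sub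
    (((h 0 1).mul (h 1 0)).mul (h 2 2))).add (((h 0 1).mul (h 1 2)).mul (h 2 0))).add
    (((h 0 2).mul (h 1 0)).mul (h 2 1))).sub (((h 0 2).mul (h 1 1)).mul (h 2 0))
  have e : (fun w => (B w).det) = _ := funext fun w => det_fin_three (B w)
  rw [e]
  refine ⟨_, hD, fun v => ?_⟩
  simp [det_fin_three, Fin.sum_univ_three, updateRow_apply]
  ring

/-- The matrix of partial derivatives. -/
noncomputable def partials (a : (Fin 4 → ℝ) → Fin 3 → ℝ) (w : Fin 4 → ℝ) :
    Matrix (Fin 3) (Fin 4) ℝ :=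
  of fun j ν => fderiv ℝ a w (Pi.single ν 1) j

/-- The vector field formed by the maximal minors of the matrix of partial derivatives. -/
noncomputable def cofactorField (a : (Fin 4 → ℝ) → Fin 3 → ℝ) (μ : Fin 4) (w : Fin 4 → ℝ) : ℝ :=
  (-1) ^ (μ : ℕ) * ((partials a w).submatrix id μ.succAbove).det

theorem contDiff_partials {a : (Fin 4 → ℝ) → Fin 3 → ℝ} (ha : ContDiff ℝ 2 a) (j : Fin 3)
    (ν : Fin 4) : ContDiff ℝ 1 fun w => partials a w j ν := by
  have h1 : ContDiff ℝ 1 (fderiv ℝ a) := ha.fderiv_right (by norm_num)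
  exact contDiff_pi.mp (h1.clm_apply contDiff_const) j

theorem contDiff_cofactorField {a : (Fin 4 → ℝ) → Fin 3 → ℝ} (ha : ContDiff ℝ 2 a) (μ : Fin 4) :
    ContDiff ℝ 1 (cofactorField a μ) := by
  have h := contDiff_partials ha
  unfold cofactorField
  simp only [det_fin_three, submatrix_apply, id]
  fun_prop

theorem fderiv_partials_apply {a : (Fin 4 → ℝ) → Fin 3 → ℝ} (ha : ContDiff ℝ 2 a) (j : Fin 3)
    (ν μ : Fin 4) (w : Fin 4 → ℝ) : fderiv ℝ (fun w => partials a w j ν) w (Pi.single μ 1) =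
      fderiv ℝ (fderiv ℝ a) w (Pi.single μ 1) (Pi.single ν 1) j := by
  have h1 : DifferentiableAt ℝ (fderiv ℝ a) w :=
    (ha.fderiv_right (m := 1) (by norm_num)).differentiable one_ne_zero w
  have h2 := hasFDerivAt_pi'.mp (h1.hasFDerivAt.clm_apply
    (hasFDerivAt_const (Pi.single ν 1 : Fin 4 → ℝ) w)) j
  have h3 : (fun w => partials a w j ν) = fun w => fderiv ℝ a w (Pi.single ν 1) j := rfl
  rw [h3, h2.fderiv]
  simp

/-- The field of maximal minors is free of divergence. -/
theorem sum_fderiv_cofactorField {a : (Fin 4 → ℝ) → Fin 3 → ℝ} (ha : ContDiff ℝ 2 a)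
    (w : Fin 4 → ℝ) : ∑ μ, fderiv ℝ (cofactorField a μ) w (Pi.single μ 1) = 0 := by
  set S : Fin 3 → Fin 4 → Fin 4 → ℝ :=
    fun j μ ν => fderiv ℝ (fderiv ℝ a) w (Pi.single μ 1) (Pi.single ν 1) j with hS
  have hsymm : ∀ j μ ν, S j μ ν = S j ν μ := fun j μ ν => congrFun
    ((ha.contDiffAt (x := w)).isSymmSndFDerivAt (by simp) (Pi.single μ 1) (Pi.single ν 1)) j
  have key : ∀ μ, fderiv ℝ (cofactorField a μ) w (Pi.single μ 1) = (-1) ^ (μ : ℕ) *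
      ∑ i, (((partials a w).submatrix id μ.succAbove).updateRow i
        fun j => S i μ (μ.succAbove j)).det := by
    intro μ
    obtain ⟨D, hD, hDv⟩ := hasFDerivAt_det_fin_three
      (B := fun w => (partials a w).submatrix id μ.succAbove) (w := w)
      fun i j => ((contDiff_partials ha i (μ.succAbove j)).differentiable one_ne_zero
        w).hasFDerivAt
    have h1 : HasFDerivAt (cofactorField a μ) ((-1 : ℝ) ^ (μ : ℕ) • D) w := hD.const_mul _
    rw [h1.fderiv, _root_.smul_apply, hDv, smul_eq_mul]
    simp only [fderiv_partials_apply ha, hS]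
  simp only [key, Fin.sum_univ_four, Fin.sum_univ_three, det_fin_three, updateRow_apply,
    submatrix_apply, id]
  simp [Fin.succAbove, Fin.lt_def]
  rw [hsymm 0 1 0, hsymm 0 2 0, hsymm 0 3 0, hsymm 0 2 1, hsymm 0 3 1, hsymm 0 3 2,
    hsymm 1 1 0, hsymm 1 2 0, hsymm 1 3 0, hsymm 1 2 1, hsymm 1 3 1, hsymm 1 3 2,
    hsymm 2 1 0, hsymm 2 2 0, hsymm 2 3 0, hsymm 2 2 1, hsymm 2 3 1, hsymm 2 3 2]
  ring

end Matrix

end CofactorField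

section DegreeObstruction

namespace Matrix

open MeasureTheory

theorem exists_contDiff_step {η : ℝ} (hη : 0 < η) : ∃ R φ : ℝ → ℝ, ContDiff ℝ 2 R ∧
    (∀ s, HasDerivAt R (φ s) s) ∧ (∀ s, 0 ≤ φ s) ∧ 0 < φ 0 ∧ ∀ s, η ≤ |s| → φ s = 0 := by
  let φ : ContDiffBump (0 : ℝ) := ⟨η / 2, η, by positivity, by linarith⟩
  have hd : ∀ s, HasDerivAt (fun s => ∫ t in (0 : ℝ)..s, φ t) (φ s) s := fun s =>
    intervalIntegral.integral_hasDerivAt_right (φ.continuous.intervalIntegrable _ _)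
      (φ.continuous.stronglyMeasurableAtFilter _ _) φ.continuous.continuousAt
  refine ⟨_, φ, ?_, hd, fun s => φ.nonneg, φ.pos_of_mem_ball (Metric.mem_ball_self hη),
    fun s hs => φ.zero_of_le_dist (by rwa [Real.dist_0_eq_abs])⟩
  rw [show (2 : WithTop ℕ∞) = 1 + 1 by norm_num, contDiff_succ_iff_deriv]
  refine ⟨fun s => (hd s).differentiableAt, by simp, ?_⟩
  rw [funext fun s => (hd s).deriv]
  exact φ.contDiff

theorem partials_comp {P : (Fin 4 → ℝ) → Fin 3 → ℝ} {w : Fin 4 → ℝ} (hP : DifferentiableAt ℝ P w)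
    {R φ : ℝ → ℝ} (hR : ∀ s, HasDerivAt R (φ s) s) (j : Fin 3) (ν : Fin 4) :
    partials (fun w j => R (P w j)) w j ν = φ (P w j) * partials P w j ν := by
  have h1 : HasFDerivAt (fun w j => R (P w j)) (ContinuousLinearMap.pi fun j =>
      φ (P w j) • (ContinuousLinearMap.proj j).comp (fderiv ℝ P w)) w :=
    hasFDerivAt_pi.mpr fun j =>
      (hR (P w j)).comp_hasFDerivAt w (hasFDerivAt_pi'.mp hP.hasFDerivAt j)
  simp [partials, h1.fderiv]

theorem cofactorField_comp_eq_zero {P : (Fin 4 → ℝ) → Fin 3 → ℝ} {w : Fin 4 → ℝ}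
    (hP : DifferentiableAt ℝ P w) {R φ : ℝ → ℝ} (hR : ∀ s, HasDerivAt R (φ s) s) (μ : Fin 4)
    {j : Fin 3} (hj : φ (P w j) = 0) : cofactorField (fun w j => R (P w j)) μ w = 0 := by
  rw [cofactorField, det_eq_zero_of_row_eq_zero j, mul_zero]
  intro k
  rw [submatrix_apply, id, partials_comp hP hR, hj, zero_mul]

theorem cofactorField_comp_affine {P : (Fin 4 → ℝ) → Fin 3 → ℝ} {w : Fin 4 → ℝ} {s : ℝ}
    {i : Fin 3 → ℝ} (hP : P =ᶠ[𝓝 w] fun w => s • (Fin.tail w - i)) {R φ : ℝ → ℝ}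
    (hR : ∀ s, HasDerivAt R (φ s) s) :
    cofactorField (fun w j => R (P w j)) 0 w = ∏ j, φ (P w j) * s := by
  have h1 : HasFDerivAt P (s • ContinuousLinearMap.pi fun j : Fin 3 =>
      ContinuousLinearMap.proj (R := ℝ) (φ := fun _ : Fin 4 => ℝ) j.succ) w := by
    refine HasFDerivAt.congr_of_eventuallyEq (HasFDerivAt.const_smul (HasFDerivAt.sub_const i ?_) s)
      hP
    exact (ContinuousLinearMap.pi fun j : Fin 3 =>
      ContinuousLinearMap.proj (R := ℝ) (φ := fun _ : Fin 4 => ℝ) j.succ).hasFDerivAt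
  rw [cofactorField]
  have h2 : (partials (fun w j => R (P w j)) w).submatrix id (0 : Fin 4).succAbove =
      diagonal fun j => φ (P w j) * s := by
    ext j k
    rw [submatrix_apply, id, partials_comp h1.differentiableAt hR, diagonal_apply]
    simp only [partials, h1.fderiv, of_apply, Fin.zero_succAbove]
    split_ifs with h
    · simp [h]
    · simp [Pi.single_apply, h]
  rw [h2, det_diagonal]
  simp

/-- A homotopy of maps to the nonzero quaternions cannot remove simple zeros of the vector part
which all have the same sign. -/
theorem false_of_same_sign {Q : (Fin 4 → ℝ) → (Fin 3 → ℝ) × ℝ} (hQ : Continuous Q) {c : ℝ}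
    (hc : 0 < c) (hcQ : ∀ w, c ≤ ‖Q w‖) (htop : ∀ w, 1 ≤ w 0 → 0 < (Q w).2)
    (hside : ∀ w (j : Fin 3), w j.succ ∉ Set.Ioo 0 1 → 0 < (Q w).2)
    {T : Finset (Fin 3 → ℝ)} (hT : T.Nonempty) {s : ℝ} (hs : 0 < s)
    (hbot : ∀ w, w 0 ≤ 0 → (Q w).2 < 0 → ∃ i ∈ T, ‖s • (Fin.tail w - i)‖ < 1 / 2)
    (hloc : ∀ i ∈ T, ∀ w, w 0 ≤ 0 → ‖s • (Fin.tail w - i)‖ < 1 / 2 →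
      (Q w).1 = s • (Fin.tail w - i) ∧ (Q w).2 < 0) : False := by
  have htail : Continuous (Fin.tail : (Fin 4 → ℝ) → Fin 3 → ℝ) :=
    continuous_pi fun j => continuous_apply j.succ
  have htailC : ∀ i, ContDiff ℝ 2 fun w : Fin 4 → ℝ => s • (Fin.tail w - i) := fun i => by
    refine ContDiff.const_smul s (ContDiff.sub (contDiff_pi.mpr fun j => ?_) contDiff_const)
    exact contDiff_apply ℝ ℝ j.succ
  obtain ⟨η, hη, hηc, hη8⟩ : ∃ η > 0, 2 * η ≤ c ∧ 2 * η ≤ 1 / 4 :=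
    ⟨min (c / 2) (1 / 8), by positivity, by linarith [min_le_left (c / 2) (1 / 8)],
      by linarith [min_le_right (c / 2) (1 / 8)]⟩
  obtain ⟨R, φ, hR2, hR, hφ0, hφ, hφη⟩ := exists_contDiff_step hη
  set S : Set (Fin 4 → ℝ) :=
    {w | w 0 ≤ -(1 / 2)} ∩ ⋃ i ∈ T, {w | ‖s • (Fin.tail w - i)‖ ≤ 1 / 4} with hS
  have hScl : IsClosed S := by
    refine (isClosed_le (by fun_prop) continuous_const).inter
      (isClosed_biUnion_finset fun i _ => isClosed_le (by fun_prop) continuous_const)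
  set U : Set (Fin 4 → ℝ) :=
    {w | w 0 < 0} ∩ ⋃ i ∈ T, {w | ‖s • (Fin.tail w - i)‖ < 1 / 2} with hU
  have hUo : IsOpen U := by
    refine (isOpen_lt (by fun_prop) continuous_const).inter
      (isOpen_biUnion fun i _ => isOpen_lt (by fun_prop) continuous_const)
  have hSU : S ⊆ U := by
    rintro w ⟨h0, hw⟩
    obtain ⟨i, hi, hwi⟩ := Set.mem_iUnion₂.mp hw
    have h0' : w 0 ≤ -(1 / 2) := h0
    have hwi' : ‖s • (Fin.tail w - i)‖ ≤ 1 / 4 := hwi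
    refine ⟨show w 0 < 0 by linarith, Set.mem_iUnion₂.mpr ⟨i, hi, ?_⟩⟩
    change ‖s • (Fin.tail w - i)‖ < 1 / 2
    linarith
  have hUd : ContDiffOn ℝ (2 : ℕ∞) (fun w => (Q w).1) U := by
    rintro w ⟨h0, hw⟩
    obtain ⟨i, hi, hwi⟩ := Set.mem_iUnion₂.mp hw
    have h1 : ∀ᶠ w' : Fin 4 → ℝ in 𝓝 w, w' 0 < 0 :=
      (isOpen_lt (by fun_prop) continuous_const).mem_nhds h0
    have h2 : ∀ᶠ w' : Fin 4 → ℝ in 𝓝 w, ‖s • (Fin.tail w' - i)‖ < 1 / 2 :=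
      (isOpen_lt (by fun_prop) continuous_const).mem_nhds hwi
    refine ((htailC i).contDiffAt.congr_of_eventuallyEq ?_).contDiffWithinAt
    filter_upwards [h1, h2] with w' h1 h2 using (hloc i hi w' h1.le h2).1
  obtain ⟨P, hP, hPQ, hPS, -⟩ := Continuous.exists_contDiff_approx_and_eqOn (n := 2)
    (f := fun w => (Q w).1) (by fun_prop) (ε := fun _ => η) continuous_const (fun _ => hη) hScl
    (hUo.mem_nhdsSet.mpr hSU) hUd
  have hPd : Differentiable ℝ P := hP.differentiable two_ne_zero
  set a : (Fin 4 → ℝ) → Fin 3 → ℝ := fun w j => R (P w j) with ha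
  have ha2 : ContDiff ℝ 2 a := contDiff_pi.mpr fun j => hR2.comp (contDiff_pi.mp hP j)
  have hY := contDiff_cofactorField ha2
  have hlarge : ∀ w μ, 2 * η ≤ ‖(Q w).1‖ → cofactorField a μ w = 0 := by
    intro w μ hw
    obtain ⟨j, hj⟩ : ∃ j, 2 * η ≤ ‖(Q w).1 j‖ := by
      by_contra! hlt
      exact hw.not_gt ((pi_norm_lt_iff (by positivity)).mpr hlt)
    refine cofactorField_comp_eq_zero (hPd w) hR μ (j := j) (hφη _ ?_)
    have h1 := (dist_le_pi_dist (P w) (Q w).1 j).trans_lt (hPQ w)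
    rw [Real.dist_eq] at h1
    rw [Real.norm_eq_abs] at hj
    have h2 := abs_sub_abs_le_abs_sub ((Q w).1 j) (P w j)
    rw [abs_sub_comm] at h2
    linarith
  have hvan : ∀ w μ, |(Q w).2| < c → cofactorField a μ w = 0 := by
    intro w μ hw
    refine hlarge w μ (hηc.trans ?_)
    rcases le_max_iff.mp (hcQ w) with h | h
    · exact h
    · exact absurd h (by rwa [not_le])
  classical
  set X : Fin 4 → (Fin 4 → ℝ) → ℝ :=
    fun μ w => if (Q w).2 < 0 then cofactorField a μ w else 0 with hX
  set X' : Fin 4 → (Fin 4 → ℝ) → (Fin 4 → ℝ) →L[ℝ] ℝ :=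
    fun μ w => if (Q w).2 < 0 then fderiv ℝ (cofactorField a μ) w else 0 with hX'
  have hXd : ∀ μ w, HasFDerivAt (X μ) (X' μ w) w := by
    intro μ w
    by_cases hw : (Q w).2 < 0
    · have h1 : X' μ w = fderiv ℝ (cofactorField a μ) w := if_pos hw
      rw [h1]
      refine ((hY μ).differentiable one_ne_zero w).hasFDerivAt.congr_of_eventuallyEq ?_
      have h2 : ∀ᶠ w' in 𝓝 w, (Q w').2 < 0 :=
        (isOpen_lt (by fun_prop) continuous_const).mem_nhds hw
      filter_upwards [h2] with w' h2 using if_pos h2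
    · have h1 : X' μ w = 0 := if_neg hw
      rw [h1]
      refine (hasFDerivAt_const (0 : ℝ) w).congr_of_eventuallyEq ?_
      have h2 : ∀ᶠ w' in 𝓝 w, -c < (Q w').2 :=
        (isOpen_lt continuous_const (by fun_prop)).mem_nhds (show -c < (Q w).2 by linarith)
      filter_upwards [h2] with w' h2
      simp only [hX]
      split_ifs with h3
      · exact hvan w' μ (abs_lt.mpr ⟨h2, by linarith⟩)
      · rfl
  have hXc : ∀ μ, Continuous (X μ) := fun μ =>
    continuous_iff_continuousAt.mpr fun w => (hXd μ w).continuousAt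
  have hdiv : ∀ w, ∑ μ, X' μ w (Pi.single μ 1) = 0 := by
    intro w
    by_cases hw : (Q w).2 < 0
    · simp only [hX', if_pos hw]
      exact sum_fderiv_cofactorField ha2 w
    · simp [hX', if_neg hw]
  have hX0 : ∀ μ w, 0 < (Q w).2 → X μ w = 0 := fun μ w hw => if_neg hw.not_gt
  have hins : ∀ (t : ℝ) (x : Fin 3 → ℝ), Fin.tail (Fin.insertNth 0 t x : Fin 4 → ℝ) = x :=
    fun t x => by rw [Fin.insertNth_zero']; exact Fin.tail_cons _ _
  set g : (Fin 3 → ℝ) → ℝ := fun x => X 0 (Fin.insertNth 0 (-1) x) with hg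
  have hgc : Continuous g := (hXc 0).comp (continuous_const.finInsertNth 0 continuous_id)
  have hint : ∫ x in Set.Icc (fun _ => -1) (fun _ => 1), g x = 0 := by
    have h := integral_divergence_of_hasFDerivAt_off_countable' (n := 3) (fun _ => -1) (fun _ => 1)
      (fun _ => by norm_num) X X' ∅ Set.countable_empty (fun μ => (hXc μ).continuousOn)
      (fun w _ μ => hXd μ w) (by simp only [hdiv]; exact integrableOn_zero)
    simp only [hdiv, integral_zero, Fin.sum_univ_succ (n := 3)] at h
    have h1 : ∀ x : Fin 3 → ℝ, X 0 (Fin.insertNth 0 1 x) = 0 := fun x =>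
      hX0 0 _ (htop _ (by simp))
    have h2 : ∀ (i : Fin 3) (x : Fin 3 → ℝ), X i.succ (Fin.insertNth i.succ 1 x) = 0 :=
      fun i x => hX0 _ _ (hside _ i (by simp))
    have h3 : ∀ (i : Fin 3) (x : Fin 3 → ℝ), X i.succ (Fin.insertNth i.succ (-1) x) = 0 :=
      fun i x => hX0 _ _ (hside _ i (by simp))
    simp only [h1, h2, h3, integral_zero, sub_zero, Finset.sum_const_zero, add_zero, zero_sub] at h
    have h4 := neg_eq_zero.mp h.symm
    exact h4
  have hgval : ∀ x, ∀ i ∈ T, ‖s • (x - i)‖ < 1 / 4 →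
      g x = ∏ j, φ (P (Fin.insertNth 0 (-1) x) j) * s := by
    intro x i hi hx
    set w : Fin 4 → ℝ := Fin.insertNth 0 (-1) x with hw
    have hw0 : w 0 = -1 := by simp [hw]
    have hwt : Fin.tail w = x := hins _ _
    have h1 : (Q w).2 < 0 := (hloc i hi w (by rw [hw0]; norm_num) (by rw [hwt]; linarith)).2
    have h2 : g x = cofactorField a 0 w := if_pos h1
    rw [h2]
    refine cofactorField_comp_affine (i := i) ?_ hR
    have h3 : ∀ᶠ w' : Fin 4 → ℝ in 𝓝 w, w' 0 < -(1 / 2) :=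
      (isOpen_lt (by fun_prop) continuous_const).mem_nhds
        (show w 0 < -(1 / 2) by rw [hw0]; norm_num)
    have h4 : ∀ᶠ w' : Fin 4 → ℝ in 𝓝 w, ‖s • (Fin.tail w' - i)‖ < 1 / 4 :=
      (isOpen_lt (by fun_prop) continuous_const).mem_nhds
        (show ‖s • (Fin.tail w - i)‖ < 1 / 4 by rwa [hwt])
    filter_upwards [h3, h4] with w' h3 h4
    have h5 : w' ∈ S := ⟨h3.le, Set.mem_iUnion₂.mpr ⟨i, hi, h4.le⟩⟩
    rw [hPS h5]
    exact (hloc i hi w' (by linarith) (by linarith)).1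
  have hg0 : ∀ x, 0 ≤ g x := by
    intro x
    by_cases hw : (Q (Fin.insertNth 0 (-1) x)).2 < 0
    · obtain ⟨i, hi, hxi⟩ := hbot _ (by simp) hw
      rw [hins] at hxi
      by_cases hx : ‖s • (x - i)‖ < 1 / 4
      · rw [hgval x i hi hx]
        exact Finset.prod_nonneg fun j _ => mul_nonneg (hφ0 _) hs.le
      · have h1 := (hloc i hi (Fin.insertNth 0 (-1) x) (by simp) (by rwa [hins])).1
        rw [hins] at h1
        have h2 : g x = cofactorField a 0 (Fin.insertNth 0 (-1) x) := if_pos hw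
        rw [h2, hlarge]
        rw [h1]
        linarith
    · have h2 : g x = 0 := if_neg hw
      rw [h2]
  obtain ⟨i, hi⟩ := hT
  set w : Fin 4 → ℝ := Fin.insertNth 0 (-1) i with hw
  have hwt : Fin.tail w = i := hins _ _
  have hwQ := hloc i hi w (by simp [hw]) (by simp [hwt])
  have hgi : g i ≠ 0 := by
    rw [hgval i i hi (by simp)]
    have h1 : P w = 0 := by
      have h2 : w ∈ S := by
        refine ⟨?_, Set.mem_iUnion₂.mpr ⟨i, hi, ?_⟩⟩
        · change w 0 ≤ _
          norm_num [hw]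
        · change ‖s • (Fin.tail w - i)‖ ≤ 1 / 4
          simp [hwt]
      rw [hPS h2]
      simp [hwQ.1, hwt]
    rw [h1]
    exact (Finset.prod_pos fun j _ => mul_pos hφ hs).ne'
  refine hint.not_gt ?_
  rw [setIntegral_pos_iff_support_of_nonneg_ae (Filter.Eventually.of_forall hg0)
    (hgc.continuousOn.integrableOn_compact isCompact_Icc)]
  have hopen : IsOpen (Function.support g ∩ Set.univ.pi fun _ => Set.Ioo (-1 : ℝ) 1) :=
    hgc.isOpen_support.inter (isOpen_set_pi Set.finite_univ fun _ _ => isOpen_Ioo)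
  refine (hopen.measure_pos volume ⟨i, hgi, fun j _ => ?_⟩).trans_le (measure_mono ?_)
  · by_contra hj
    refine hwQ.2.not_gt (hside w j fun hj' => hj ?_)
    have h1 : w j.succ = i j := congrFun hwt j
    rw [h1] at hj'
    exact ⟨by linarith [hj'.1], hj'.2⟩
  · refine Set.inter_subset_inter_right _ fun x hx => ⟨fun j => ?_, fun j => ?_⟩
    · exact (hx j trivial).1.le
    · exact (hx j trivial).2.le

end Matrix

end DegreeObstruction

section InfiniteOrder

namespace Matrix

open scoped Topology.Homotopy unitInterval

theorem cubeClamp_mem_boundary {y : Fin 3 → ℝ} {j : Fin 3} (hj : y j ∉ Set.Ioo 0 1) :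
    cubeClamp y ∈ Cube.boundary (Fin 3) := by
  refine ⟨j, ?_⟩
  rcases le_or_gt (y j) 0 with h | h
  · exact Or.inl (Set.projIcc_of_le_left _ h)
  · exact Or.inr (Set.projIcc_of_right_le _ (not_lt.mp fun h1 => hj ⟨h, h1⟩))

theorem cubeVal_cubeClamp {y : Fin 3 → ℝ} (hy : ∀ j, y j ∈ Set.Ioo 0 1) :
    cubeVal (cubeClamp y) = y := by
  funext j
  exact congrArg Subtype.val (Set.projIcc_of_mem zero_le_one (Set.Ioo_subset_Icc_self (hy j)))

variable (N : ℕ)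

theorem quatCoord_one : quatCoord (1 : specialUnitaryGroup (Fin (2 + N)) ℂ) = (0, 1) := by
  rw [← quatSU_of_pos N one_pos, quatCoord_quatSU (by simp)]
  simp [sqNorm]

theorem not_homotopic_const {h : (I^Fin 3) → (Fin 3 → ℝ) × ℝ} (hh : IsQuatLoop h)
    {T : Finset (Fin 3 → ℝ)} (hT : T.Nonempty) {s : ℝ} (hs : 0 < s)
    (hbot : ∀ y, (h (cubeClamp y)).2 < 0 → ∃ i ∈ T, ‖s • (y - i)‖ < 1 / 2)
    (hloc : ∀ i ∈ T, ∀ y, ‖s • (y - i)‖ < 1 / 2 →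
      (h (cubeClamp y)).1 = s • (y - i) ∧ (h (cubeClamp y)).2 < 0) :
    ¬GenLoop.Homotopic (quatLoop N hh) GenLoop.const := by
  rintro ⟨F⟩
  have hhc := hh.continuous
  set B : Set (I × (I^Fin 3)) := {z | z.1 = 0 ∨ z.1 = 1 ∨ z.2 ∈ Cube.boundary (Fin 3)} with hB
  have hF0 : ∀ x, F (0, x) = quatSU N (h x) := fun x => F.apply_zero x
  have hF1 : ∀ z : I × (I^Fin 3), z.1 = 1 ∨ z.2 ∈ Cube.boundary (Fin 3) → F z = 1 := by
    rintro ⟨t, x⟩ (rfl | hx)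
    · exact F.apply_one x
    · exact (F.eq_fst t hx).trans (GenLoop.boundary (quatLoop N hh) x hx)
  have hfix1 : FixesFrom 2 (1 : specialUnitaryGroup (Fin (2 + N)) ℂ) := fun _ _ => one_mulVec _
  set r : (Fin 4 → ℝ) → I × (I^Fin 3) :=
    fun w => (Set.projIcc 0 1 zero_le_one (w 0), cubeClamp (Fin.tail w)) with hr
  have htail : Continuous (Fin.tail : (Fin 4 → ℝ) → Fin 3 → ℝ) :=
    continuous_pi fun j => continuous_apply j.succ
  have hrc : Continuous r := by
    have := continuous_cubeClamp
    fun_prop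
  obtain ⟨g, ⟨F'⟩, hg⟩ := exists_homotopicRel_fixesFrom_two (W := Fin 4 → ℝ) (by simp)
    (ι := fun z : I × (I^Fin 3) => (Fin.cons (z.1 : ℝ) (cubeVal z.2) : Fin 4 → ℝ)) (r := r) (by
      have := continuous_cubeVal
      exact Continuous.finCons (by fun_prop) (by fun_prop)) hrc
    (fun z => Prod.ext (Set.projIcc_val zero_le_one z.1) (cubeClamp_cubeVal z.2)) (B := B)
    (F : C(I × (I^Fin 3), specialUnitaryGroup (Fin (2 + N)) ℂ)) (by
      rintro ⟨t, x⟩ (h0 | h1)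
      · obtain rfl : t = 0 := h0
        exact (hF0 x).symm ▸ fixesFrom_quatSU N (h x)
      · exact (hF1 (t, x) h1).symm ▸ hfix1)
  have hgF : ∀ z ∈ B, g z = F z := fun z hz => by
    rw [← F'.apply_one, F'.eq_fst 1 hz]
    rfl
  set q : I × (I^Fin 3) → (Fin 3 → ℝ) × ℝ := fun z => √(sqNorm (h z.2)) • quatCoord (g z) with hq
  have hroot : ∀ x, 0 < √(sqNorm (h x)) := fun x => Real.sqrt_pos.mpr (sqNorm_pos (hh.ne_zero x))
  have hqc : Continuous q := by
    have h1 := continuous_sqNorm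
    have h2 := continuous_quatCoord (N := N)
    fun_prop
  have hq0 : ∀ x, q (0, x) = h x := fun x => by
    simp only [hq]
    rw [hgF _ (Or.inl rfl), hF0, quatCoord_quatSU (hh.ne_zero x), smul_smul,
      mul_inv_cancel₀ (hroot x).ne', one_smul]
  have hq1 : ∀ z : I × (I^Fin 3), z.1 = 1 ∨ z.2 ∈ Cube.boundary (Fin 3) → 0 < (q z).2 := by
    intro z hz
    simp only [hq]
    rw [hgF z (Or.inr hz), hF1 z hz, quatCoord_one]
    simpa using hroot z.2
  have hqne : ∀ z, q z ≠ 0 := fun z => by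
    refine smul_ne_zero (hroot _).ne' fun h0 => ?_
    have := sqNorm_quatCoord (hg z)
    rw [h0] at this
    simp [sqNorm] at this
  obtain ⟨c, hc, hcq⟩ := isCompact_univ.exists_forall_le' (f := fun z => ‖q z‖) (a := 0)
    hqc.norm.continuousOn fun z _ => norm_pos_iff.mpr (hqne z)
  have hr0 : ∀ w : Fin 4 → ℝ, w 0 ≤ 0 → q (r w) = h (cubeClamp (Fin.tail w)) := by
    intro w hw
    rw [← hq0]
    simp only [hr, Set.projIcc_of_le_left _ hw]
    rfl
  refine false_of_same_sign (Q := fun w => q (r w)) (by fun_prop) hc (fun w => hcq _ trivial)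
    (fun w hw => hq1 _ (Or.inl (Set.projIcc_of_right_le zero_le_one hw)))
    (fun w j hj => hq1 _ (Or.inr (cubeClamp_mem_boundary (j := j) hj))) hT hs
    (fun w hw hw2 => ?_) fun i hi w hw hwi => ?_
  · rw [hr0 w hw] at hw2
    exact hbot _ hw2
  · simp only [hr0 w hw]
    exact hloc i hi _ hwi

theorem toClass_localLoop_smul {s : ℝ} (hs : 0 < s) {i : Fin 3 → ℝ} (hi : ∀ j, i j ∈ Set.Ioo 0 1)
    (h : IsLocal Set.univ fun x => s • (cubeVal x - i)) :
    GenLoop.toClass (localLoop N h) = generator N := by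
  set B : I → Matrix (Fin 3) (Fin 3) ℝ := fun t => ((1 - t) * s + t * 4 : ℝ) • 1 with hB
  set c : I → Fin 3 → ℝ := fun t => (1 - t : ℝ) • i + (t : ℝ) • fun _ => 1 / 2 with hc
  have e₀ : (fun x => s • (cubeVal x - i)) = fun x => B 0 *ᵥ (cubeVal x - c 0) := by
    simp [hB, hc, smul_mulVec]
  have e₁ : (fun x => ((4 : ℝ) • diagonal (1 : Fin 3 → ℝ)) *ᵥ (cubeVal x - fun _ => 1 / 2)) =
      fun x => B 1 *ᵥ (cubeVal x - c 1) := by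
    have : diagonal (1 : Fin 3 → ℝ) = 1 := diagonal_one
    simp [hB, hc, this]
  suffices key : ∀ h₁ : IsLocal Set.univ fun x =>
      ((4 : ℝ) • diagonal (1 : Fin 3 → ℝ)) *ᵥ (cubeVal x - fun _ => 1 / 2),
      GenLoop.Homotopic (localLoop N h) (localLoop N h₁) from
    GenLoop.toClass_eq_iff.mpr (key isLocal_generator)
  revert h
  rw [e₀, e₁]
  intro h h₁
  refine localLoop_homotopic_of_path N (by fun_prop) (fun t => ?_) (by fun_prop) (fun t j => ?_)
    h h₁
  · rw [hB, det_smul, det_one, mul_one]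
    have h1 := mul_nonneg (sub_nonneg.mpr t.2.2) hs.le
    have h2 := t.2.1
    refine pow_ne_zero _ (ne_of_gt ?_)
    rcases h2.eq_or_lt with h3 | h3
    · rw [← h3]
      simpa using hs
    · positivity
  · have := convex_Ioo (0 : ℝ) 1 (hi j) (show (1 / 2 : ℝ) ∈ Set.Ioo 0 1 by norm_num)
      (sub_nonneg.mpr t.2.2) t.2.1 (by ring)
    simpa [hc] using this

theorem exists_quatLoop_pow {s : ℝ} (hs : 0 < s) (T : Finset (Fin 3 → ℝ))
    (hT : ∀ i ∈ T, ∀ y, ‖s • (y - i)‖ < 1 → ∀ j, y j ∈ Set.Ioo (0 : ℝ) 1)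
    (hsep : ∀ i ∈ T, ∀ j ∈ T, ∀ y, ‖s • (y - i)‖ < 1 → ‖s • (y - j)‖ < 1 → i = j) :
    ∃ (h : (I^Fin 3) → (Fin 3 → ℝ) × ℝ) (hh : IsQuatLoop h),
      GenLoop.toClass (quatLoop N hh) = generator N ^ T.card ∧
      (∀ i ∈ T, ∀ x, ‖s • (cubeVal x - i)‖ < 1 → h x = bubble (s • (cubeVal x - i))) ∧
      ∀ x, (∀ i ∈ T, 1 ≤ ‖s • (cubeVal x - i)‖) → h x = (0, 1) := by
  classical
  induction T using Finset.induction_on with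
  | empty =>
    have hh : IsQuatLoop fun _ => (0, 1) := ⟨continuous_const, by simp, by simp⟩
    refine ⟨_, hh, ?_, by simp, by simp⟩
    have : quatLoop N hh = GenLoop.const := by
      ext1 x
      exact quatSU_of_pos N one_pos
    rw [this]
    rfl
  | insert i T hi ih =>
    obtain ⟨h, hh, hcl, hin, hout⟩ := ih
      (fun j hj => hT j (Finset.mem_insert_of_mem hj))
      fun j hj k hk => hsep j (Finset.mem_insert_of_mem hj) k (Finset.mem_insert_of_mem hk)
    have hv := continuous_cubeVal
    have hb := continuous_bubble
    have hhc := hh.continuous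
    set p : (I^Fin 3) → Fin 3 → ℝ := fun x => s • (cubeVal x - i) with hp
    set k : (I^Fin 3) → (Fin 3 → ℝ) × ℝ := fun x => h x + (bubble (p x) - (0, 1)) with hk
    have hnear : ∀ x, ‖p x‖ < 1 → h x = (0, 1) := fun x hx => hout x fun j hj => by
      by_contra! hlt
      exact hi (hsep i (Finset.mem_insert_self i T) j (Finset.mem_insert_of_mem hj) _ hx hlt ▸ hj)
    have hk1 : ∀ x, ‖p x‖ < 1 → k x = bubble (p x) := fun x hx => by
      simp only [hk]
      rw [hnear x hx, add_sub_cancel]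
    have hk2 : ∀ x, 1 ≤ ‖p x‖ → k x = h x := fun x hx => by
      simp only [hk]
      rw [bubble_of_one_le hx, sub_self, add_zero]
    have hpb : ∀ x ∈ Cube.boundary (Fin 3), 1 ≤ ‖p x‖ := by
      rintro x ⟨j, hj⟩
      by_contra! hlt
      have := hT i (Finset.mem_insert_self i T) _ hlt j
      rcases hj with hj | hj <;> simp [cubeVal, hj] at this
    have hloop : IsQuatLoop k := by
      refine ⟨by fun_prop, fun x => ?_, fun x hx => ?_⟩
      · rcases lt_or_ge ‖p x‖ 1 with hx | hx
        · rw [hk1 x hx]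
          exact bubble_ne_zero _
        · rw [hk2 x hx]
          exact hh.ne_zero x
      · rw [hk2 x (hpb x hx)]
        exact hh.boundary x hx
    have hloc : IsLocal Set.univ p := isLocal_univ_iff.mpr ⟨by fun_prop, hpb⟩
    refine ⟨k, hloop, ?_, fun j hj x hx => ?_, fun x hx => ?_⟩
    · have e : quatLoop N hloop = GenLoop.pmul (localLoop N hloc) (quatLoop N hh) := by
        ext1 x
        rw [GenLoop.pmul_apply, localLoop_apply, if_pos (Set.mem_univ x), quatLoop_apply,
          quatLoop_apply]
        rcases lt_or_ge ‖p x‖ 1 with hx | hx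
        · rw [hk1 x hx, hnear x hx, quatSU_of_pos N one_pos, mul_one]
          rfl
        · rw [hk2 x hx, bubbleSU_of_one_le N hx, one_mul]
      rw [e, GenLoop.toClass_pmul, hcl, Finset.card_insert_of_notMem hi, pow_succ,
        toClass_localLoop_smul N hs (hT i (Finset.mem_insert_self i T) i (by simp))]
    · rcases Finset.mem_insert.mp hj with rfl | hj'
      · exact hk1 x hx
      · rw [hk2 x, hin j hj' x hx]
        by_contra! hlt
        exact hi (hsep i (Finset.mem_insert_self i T) j hj _ hlt hx ▸ hj')
    · rw [hk2 x (hx i (Finset.mem_insert_self i T))]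
      exact hout x fun j hj => hx j (Finset.mem_insert_of_mem hj)

theorem not_isOfFinOrder_generator : ¬IsOfFinOrder (generator N) := by
  rw [isOfFinOrder_iff_pow_eq_one]
  rintro ⟨m, hm, hpow⟩
  have hm1 : (0 : ℝ) < m + 1 := by positivity
  set i : ℕ → Fin 3 → ℝ := fun k _ => (k + 1) / (m + 1) with hi
  have hinj : Function.Injective i := fun k l hkl => by
    have := congrFun hkl 0
    simp only [hi] at this
    field_simp at this
    simpa using this
  set s : ℝ := 2 * (m + 1) with hs
  have hs0 : 0 < s := by positivity
  have hcoord : ∀ k y, ‖s • (y - i k)‖ < 1 → ∀ j, |(m + 1) * y j - (k + 1)| < 1 / 2 := by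
    intro k y hy j
    have h1 := (norm_le_pi_norm (s • (y - i k)) j).trans_lt hy
    have h2 : (s • (y - i k)) j = 2 * ((m + 1) * y j - (k + 1)) := by
      simp only [hs, hi, Pi.smul_apply, Pi.sub_apply, smul_eq_mul]
      field_simp
    rw [h2, norm_mul, Real.norm_eq_abs, Real.norm_eq_abs, abs_two] at h1
    linarith
  obtain ⟨h, hh, hcl, hin, hout⟩ := exists_quatLoop_pow N hs0 ((Finset.range m).image i)
    (by
      simp only [Finset.mem_image, Finset.mem_range]
      rintro _ ⟨k, hk, rfl⟩ y hy j
      have h1 := abs_lt.mp (hcoord k y hy j)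
      have h2 : (k : ℝ) + 1 ≤ m := by exact_mod_cast hk
      have h3 : (0 : ℝ) ≤ k := by positivity
      constructor
      · by_contra! h4
        have := mul_nonpos_of_nonneg_of_nonpos hm1.le h4
        linarith
      · by_contra! h4
        have := mul_le_mul_of_nonneg_left h4 hm1.le
        linarith)
    (by
      simp only [Finset.mem_image, Finset.mem_range]
      rintro _ ⟨k, hk, rfl⟩ _ ⟨l, hl, rfl⟩ y hky hly
      have h1 := abs_lt.mp (hcoord k y hky 0)
      have h2 := abs_lt.mp (hcoord l y hly 0)
      have h3 : (k : ℝ) < l + 1 := by linarith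
      have h4 : (l : ℝ) < k + 1 := by linarith
      have h5 : k < l + 1 := by exact_mod_cast h3
      have h6 : l < k + 1 := by exact_mod_cast h4
      rw [show k = l by omega])
  rw [Finset.card_image_of_injective _ hinj, Finset.card_range, hpow] at hcl
  have hbd : ∀ y, (h (cubeClamp y)).2 < 0 → cubeVal (cubeClamp y) = y := fun y hy =>
    cubeVal_cubeClamp fun j => by
      by_contra hj
      exact ((hh.boundary _ (cubeClamp_mem_boundary hj)).2).not_gt hy
  refine not_homotopic_const N hh (T := (Finset.range m).image i) (by simpa using hm.ne') hs0
    (fun y hy => ?_) (fun c hc y hy => ?_) (GenLoop.toClass_eq_iff.mp hcl)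
  · by_contra! hfar
    have hyc := hbd y hy
    by_cases hc : ∀ c ∈ (Finset.range m).image i, 1 ≤ ‖s • (cubeVal (cubeClamp y) - c)‖
    · rw [hout _ hc] at hy
      norm_num at hy
    · push Not at hc
      obtain ⟨c, hc, hlt⟩ := hc
      rw [hin c hc _ hlt, hyc] at hy
      have h1 : 0 ≤ (bubble (s • (y - c))).2 := le_min zero_le_one (by linarith [hfar c hc])
      exact h1.not_gt hy
  · have h1 : cubeVal (cubeClamp y) = y := cubeVal_cubeClamp fun j => by
      obtain ⟨k, hk, rfl⟩ := Finset.mem_image.mp hc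
      have h1 := abs_lt.mp (hcoord k y (by linarith) j)
      have h2 : (k : ℝ) + 1 ≤ m := by exact_mod_cast Finset.mem_range.mp hk
      have h3 : (0 : ℝ) ≤ k := by positivity
      constructor
      · by_contra! h4
        have := mul_nonpos_of_nonneg_of_nonpos hm1.le h4
        linarith
      · by_contra! h4
        have := mul_le_mul_of_nonneg_left h4 hm1.le
        linarith
    rw [hin c hc _ (by rw [h1]; linarith), h1, bubble_of_le_half hy.le]
    exact ⟨rfl, by linarith⟩

/-- The third homotopy group of the special unitary group of size at least two is infinite
cyclic. -/
theorem nonempty_homotopyGroup_mulEquiv :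
    Nonempty (π_ 3 (specialUnitaryGroup (Fin (2 + N)) ℂ) 1 ≃* Multiplicative ℤ) :=
  ⟨(MulEquiv.ofBijective (zpowersHom _ (generator N))
    ⟨fun a b hab => Multiplicative.toAdd.injective
      (injective_zpow_iff_not_isOfFinOrder.mpr (not_isOfFinOrder_generator N) hab), fun a => by
      obtain ⟨k, hk⟩ := Subgroup.mem_zpowers_iff.mp (mem_zpowers_generator N a)
      exact ⟨Multiplicative.ofAdd k, hk⟩⟩).symm⟩

end Matrix

end InfiniteOrder

/-- The third homotopy group of `SU(8)` based at the identity is infinite cyclic: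
`π₃(SU(8), 1) ≅ ℤ`. -/
theorem pi3_SU8_int :
    Nonempty (π_ 3 (Matrix.specialUnitaryGroup (Fin 8) ℂ) 1 ≃* Multiplicative ℤ) :=
  Matrix.nonempty_homotopyGroup_mulEquiv 6
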